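/- Let g₁, g₂, g₂′ : S³ → S⁶ be smooth embeddings such that the image of g₂ and the image of g₂′ are each disjoint from the image of g₁. Suppose there exist C^∞ maps H, K : [0,1] × S³ → S⁶ such that for every t ∈ [0,1] the slices H_t and K_t are smooth embeddings with disjoint images, H₀ = g₁, K₀ = g₂, H₁ = g₁, and K₁ = g₂′. Then there exist C^∞ maps H′, K′ : [0,1] × S³ → S⁶ such that for every t ∈ [0,1] the slices H′_t and K′_t are smooth embeddings with disjoint images, H′_t = g₁ for all t ∈ [0,1], K′₀ = g₂, and K′₁ = g₂′. -/

import Mathlib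

/- STATEMENT 12 (Haefliger's lemma): Let g₁, g₂, g₂′ : S³ → S⁶ be smooth
   embeddings with Im g₂ and Im g₂′ disjoint from Im g₁. If there are smooth
   isotopies H, K (with slicewise disjoint images) with H₀ = H₁ = g₁, K₀ = g₂,
   K₁ = g₂′, then there are such isotopies H′, K′ with H′ₜ = g₁ for all t,
   K′₀ = g₂ and K′₁ = g₂′. -/

open scoped Manifold

noncomputable section

abbrev E (n : ℕ) : Type := EuclideanSpace ℝ (Fin n)
abbrev Sph (n : ℕ) : Set (E (n + 1)) := Metric.sphere 0 1

/-- A smooth embedding between spheres: a `C^∞` map which is a topological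
embedding and whose differential is injective at every point. -/
def IsSmoothEmbedding {m n : ℕ} (f : Sph m → Sph n) : Prop :=
  ContMDiff (𝓡 m) (𝓡 n) (⊤ : ℕ∞) f ∧ Topology.IsEmbedding f ∧
    ∀ x, Function.Injective (mfderiv (𝓡 m) (𝓡 n) f x)

section

open scoped ContDiff Topology Manifold
open Set Metric

section NearIdentity

variable {V : Type*} [NormedAddCommGroup V] [NormedSpace ℝ V]

theorem fderiv_slice {X Y : Type*} [NormedAddCommGroup X] [NormedSpace ℝ X]
    [NormedAddCommGroup Y] [NormedSpace ℝ Y] {u : ℝ × X → Y} (hu : ContDiff ℝ ∞ u)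
    (t : ℝ) (z : X) :
    fderiv ℝ (fun z => u (t, z)) z =
      (fderiv ℝ u (t, z)).comp (ContinuousLinearMap.inr ℝ ℝ X) := by
  have h1 : HasFDerivAt u (fderiv ℝ u (t, z)) (t, z) :=
    (hu.differentiable (by simp)).differentiableAt.hasFDerivAt
  exact (h1.comp z (hasFDerivAt_prodMk_right t z)).fderiv

theorem ContDiff.slice {X Y : Type*} [NormedAddCommGroup X] [NormedSpace ℝ X]
    [NormedAddCommGroup Y] [NormedSpace ℝ Y] {u : ℝ × X → Y} (hu : ContDiff ℝ ∞ u)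
    (t : ℝ) : ContDiff ℝ ∞ fun z => u (t, z) :=
  hu.comp (contDiff_const.prodMk contDiff_id)

theorem ContDiff.dif {X Y : Type*} [NormedAddCommGroup X] [NormedSpace ℝ X]
    [NormedAddCommGroup Y] [NormedSpace ℝ Y] {u : X → Y} (hu : ContDiff ℝ ∞ u) (x : X) :
    DifferentiableAt ℝ u x :=
  (hu.differentiable (by simp)).differentiableAt

/-- A compactly supported smooth family of maps vanishing at time zero is a contraction for
small times. -/
theorem exists_lipschitz_half_of_compact_support {u : ℝ × V → V} (hu : ContDiff ℝ ∞ u)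
    (h0 : ∀ z, u (0, z) = 0) {K : Set V} (hK : IsCompact K)
    (hs : ∀ t, ∀ z ∉ K, u (t, z) = 0) :
    ∃ δ > 0, ∀ t, |t| ≤ δ → LipschitzWith (1 / 2) (fun z => u (t, z)) := by
  have hcont : Continuous fun p : ℝ × V =>
      (fderiv ℝ u p).comp (ContinuousLinearMap.inr ℝ ℝ V) :=
    (hu.continuous_fderiv (by simp)).clm_comp continuous_const
  have hzero : ∀ z, (fderiv ℝ u (0, z)).comp (ContinuousLinearMap.inr ℝ ℝ V) = 0 := by
    intro z
    rw [← fderiv_slice hu]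
    simp [h0]
  have hev : ∀ᶠ t in 𝓝 (0 : ℝ), ∀ z ∈ K,
      ‖(fderiv ℝ u (t, z)).comp (ContinuousLinearMap.inr ℝ ℝ V)‖ < 1 / 2 := by
    refine hK.eventually_forall_of_forall_eventually fun z _ => ?_
    have : Filter.Tendsto (fun p : ℝ × V =>
        ‖(fderiv ℝ u p).comp (ContinuousLinearMap.inr ℝ ℝ V)‖) (𝓝 (0, z)) (𝓝 0) := by
      have := hcont.norm.tendsto (0, z)
      rwa [hzero, norm_zero] at this
    exact this.eventually (gt_mem_nhds (by norm_num))
  obtain ⟨δ, hδ, hball⟩ := Metric.eventually_nhds_iff.1 hev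
  refine ⟨δ / 2, half_pos hδ, fun t ht => ?_⟩
  refine lipschitzWith_of_nnnorm_fderiv_le (𝕜 := ℝ) (fun z => (hu.slice t).dif z) fun z => ?_
  by_cases hz : z ∈ K
  · have := hball (y := t) (by rw [Real.dist_eq, sub_zero]; linarith) z hz
    rw [fderiv_slice hu, ← NNReal.coe_le_coe]
    simpa using this.le
  · have : (fun z => u (t, z)) =ᶠ[𝓝 z] fun _ => 0 := by
      filter_upwards [hK.isClosed.isOpen_compl.mem_nhds hz] with y hy using hs t y hy
    rw [this.fderiv_eq]
    simp

theorem injective_add_of_lipschitz_half {V : Type*} [NormedAddCommGroup V] {w : V → V}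
    (hw : LipschitzWith (1 / 2) w) :
    Function.Injective fun z => z + w z := by
  intro x y hxy
  have h1 : x - y = w y - w x := by
    have : x + w x = y + w y := hxy
    rw [sub_eq_sub_iff_add_eq_add, this, add_comm]
  have h2 := hw.dist_le_mul y x
  rw [dist_eq_norm, ← h1, dist_comm, dist_eq_norm] at h2
  have h3 : ‖x - y‖ ≤ 0 := by
    have : ((1 / 2 : NNReal) : ℝ) = 1 / 2 := by norm_num
    rw [this] at h2
    linarith
  exact sub_eq_zero.1 (norm_le_zero_iff.1 h3)

theorem injective_id_add_of_norm_le_half {L : V →L[ℝ] V} (hL : ‖L‖ ≤ 1 / 2) :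
    Function.Injective (ContinuousLinearMap.id ℝ V + L) := by
  rw [injective_iff_map_eq_zero]
  intro x hx
  have h1 : x = -L x := eq_neg_of_add_eq_zero_left (by simpa using hx)
  have h2 : ‖x‖ ≤ 1 / 2 * ‖x‖ := by
    calc ‖x‖ = ‖-L x‖ := congrArg norm h1
      _ = ‖L x‖ := norm_neg _
      _ ≤ ‖L‖ * ‖x‖ := L.le_opNorm x
      _ ≤ 1 / 2 * ‖x‖ := by gcongr
  exact norm_le_zero_iff.1 (by linarith)

theorem fderiv_id_add {w : V → V} (hw : ContDiff ℝ ∞ w) (z : V) :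
    fderiv ℝ (fun z => z + w z) z = ContinuousLinearMap.id ℝ V + fderiv ℝ w z := by
  rw [fderiv_fun_add differentiableAt_fun_id (hw.dif z), fderiv_fun_id]

theorem norm_fderiv_le_half {w : V → V} (hw : LipschitzWith (1 / 2) w) (z : V) :
    ‖fderiv ℝ w z‖ ≤ 1 / 2 := by
  have := norm_fderiv_le_of_lipschitz ℝ hw (x₀ := z)
  simpa using this

end NearIdentity

section Isotopy

variable {W V : Type*} [NormedAddCommGroup W] [InnerProductSpace ℝ W]
  [NormedAddCommGroup V] [NormedSpace ℝ V]

/-- The restriction of `f` to the unit sphere of `W` is an injective immersion. -/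
def SphereEmb (f : W → V) : Prop :=
  InjOn f (sphere 0 1) ∧
    ∀ x ∈ sphere (0 : W) 1, ∀ u : W, inner ℝ x u = 0 → fderiv ℝ f x u = 0 → u = 0

/-- `f₀` and `f₁` are isotopic through embeddings of the unit sphere of `W` avoiding `A`. -/
def Isotopic (A : Set V) (f₀ f₁ : W → V) : Prop :=
  ∃ K : ℝ × W → V, ContDiff ℝ ∞ K ∧
    (∀ t ∈ Icc (0 : ℝ) 1, SphereEmb (fun x => K (t, x)) ∧
      ∀ x ∈ sphere (0 : W) 1, K (t, x) ∉ A) ∧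
    (∀ x, K (0, x) = f₀ x) ∧ ∀ x, K (1, x) = f₁ x

/-- `ψ` is the end of an ambient isotopy of `V` preserving `A` setwise. -/
def AmbientMove (A : Set V) (ψ : V → V) : Prop :=
  ∃ F : ℝ × V → V, ContDiff ℝ ∞ F ∧
    (∀ t ∈ Icc (0 : ℝ) 1, Function.Injective (fun z => F (t, z)) ∧
      (∀ z, Function.Injective (fderiv ℝ (fun z => F (t, z)) z)) ∧
      ∀ z, F (t, z) ∈ A ↔ z ∈ A) ∧
    (∀ z, F (0, z) = z) ∧ ∀ z, F (1, z) = ψ z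

theorem AmbientMove.contDiff {A : Set V} {ψ : V → V} (h : AmbientMove A ψ) :
    ContDiff ℝ ∞ ψ := by
  obtain ⟨F, hF, -, -, h1⟩ := h
  have := hF.slice 1
  simpa only [h1] using this

theorem AmbientMove.mem_iff {A : Set V} {ψ : V → V} (h : AmbientMove A ψ) (z : V) :
    ψ z ∈ A ↔ z ∈ A := by
  obtain ⟨F, -, hF, -, h1⟩ := h
  rw [← h1]
  exact (hF 1 (by simp)).2.2 z

theorem AmbientMove.injective {A : Set V} {ψ : V → V} (h : AmbientMove A ψ) :
    Function.Injective ψ := by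
  obtain ⟨F, -, hF, -, h1⟩ := h
  have := (hF 1 (by simp)).1
  simpa only [h1] using this

theorem AmbientMove.id (A : Set V) : AmbientMove A (fun z => z) := by
  refine ⟨Prod.snd, contDiff_snd, fun t _ => ⟨fun x y h => h, fun z => ?_, fun z => Iff.rfl⟩,
    fun _ => rfl, fun _ => rfl⟩
  simpa using Function.injective_id

theorem AmbientMove.comp {A : Set V} {ψ φ : V → V} (hψ : AmbientMove A ψ)
    (hφ : AmbientMove A φ) : AmbientMove A (fun z => ψ (φ z)) := by
  obtain ⟨F, hF, hFt, hF0, hF1⟩ := hψ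
  obtain ⟨G, hG, hGt, hG0, hG1⟩ := hφ
  refine ⟨fun p => F (p.1, G p), hF.comp (contDiff_fst.prodMk hG), fun t ht =>
    ⟨fun x y h => (hGt t ht).1 ((hFt t ht).1 h), fun z => ?_, fun z => ?_⟩, ?_, ?_⟩
  · have : fderiv ℝ (fun z => F (t, G (t, z))) z =
        (fderiv ℝ (fun z => F (t, z)) (G (t, z))).comp (fderiv ℝ (fun z => G (t, z)) z) :=
      fderiv_comp z ((hF.slice t).dif _) ((hG.slice t).dif z)
    change Function.Injective (fderiv ℝ (fun z => F (t, G (t, z))) z)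
    rw [this]
    exact ((hFt t ht).2.1 _).comp ((hGt t ht).2.1 z)
  · exact ((hFt t ht).2.2 _).trans ((hGt t ht).2.2 z)
  · intro z; simp [hG0, hF0]
  · intro z; simp [hG1, hF1]

theorem AmbientMove.iterate {A : Set V} {ψ : V → V} (hψ : AmbientMove A ψ) (n : ℕ) :
    AmbientMove A (ψ^[n]) := by
  induction n with
  | zero => exact AmbientMove.id A
  | succ n ih => exact ih.comp hψ

/-- A small enough compactly supported deformation of the identity preserving `A`. -/
theorem exists_ambientMove_of_compact_support {A : Set V} {u : ℝ × V → V}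
    (hu : ContDiff ℝ ∞ u) (h0 : ∀ z, u (0, z) = 0) {K : Set V} (hK : IsCompact K)
    (hs : ∀ t, ∀ z ∉ K, u (t, z) = 0) {ε : ℝ} (hε : 0 < ε)
    (hA : ∀ t ∈ Icc 0 ε, Function.Injective (fun z => z + u (t, z)) →
      ∀ z, z + u (t, z) ∈ A ↔ z ∈ A) :
    ∃ δ > 0, ∀ t ∈ Icc 0 δ, AmbientMove A (fun z => z + u (t, z)) := by
  obtain ⟨δ, hδ, hL⟩ := exists_lipschitz_half_of_compact_support hu h0 hK hs
  refine ⟨min δ ε, lt_min hδ hε, fun t ht => ?_⟩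
  have hL' : ∀ s ∈ Icc (0 : ℝ) 1, LipschitzWith (1 / 2) (fun z => u (s * t, z)) := by
    intro s hs
    apply hL
    rw [abs_of_nonneg (mul_nonneg hs.1 ht.1)]
    exact (mul_le_of_le_one_left ht.1 hs.2).trans (ht.2.trans (min_le_left _ _))
  refine ⟨fun p => p.2 + u (p.1 * t, p.2), contDiff_snd.add
    (hu.comp ((contDiff_fst.mul contDiff_const).prodMk contDiff_snd)), fun s hs =>
    ⟨injective_add_of_lipschitz_half (hL' s hs), fun z => ?_, ?_⟩, ?_, ?_⟩
  · change Function.Injective (fderiv ℝ (fun z => z + u (s * t, z)) z)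
    rw [fderiv_id_add (hu.slice (s * t))]
    exact injective_id_add_of_norm_le_half (norm_fderiv_le_half (hL' s hs) z)
  · exact hA (s * t) ⟨mul_nonneg hs.1 ht.1, (mul_le_of_le_one_left ht.1 hs.2).trans
      (ht.2.trans (min_le_right _ _))⟩ (injective_add_of_lipschitz_half (hL' s hs))
  · intro z; simp [h0]
  · intro z; simp

theorem SphereEmb.comp {f : W → V} (hf : SphereEmb f) {V' : Type*} [NormedAddCommGroup V']
    [NormedSpace ℝ V'] {ψ : V → V'} (hfd : ContDiff ℝ ∞ f) (hψ : ContDiff ℝ ∞ ψ)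
    (hi : InjOn ψ (f '' sphere 0 1))
    (hd : ∀ x ∈ sphere (0 : W) 1, Function.Injective (fderiv ℝ ψ (f x))) :
    SphereEmb (fun x => ψ (f x)) := by
  refine ⟨fun x hx y hy h => hf.1 hx hy (hi ⟨x, hx, rfl⟩ ⟨y, hy, rfl⟩ h), fun x hx u hxu h => ?_⟩
  have : fderiv ℝ (fun x => ψ (f x)) x = (fderiv ℝ ψ (f x)).comp (fderiv ℝ f x) :=
    fderiv_comp x (hψ.dif _) (hfd.dif x)
  rw [this] at h
  exact hf.2 x hx u hxu (hd x hx (by simpa using h))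

theorem AmbientMove.isotopic {A : Set V} {ψ : V → V} (hψ : AmbientMove A ψ) {f : W → V}
    (hfd : ContDiff ℝ ∞ f) (hf : SphereEmb f) (hfA : ∀ x ∈ sphere (0 : W) 1, f x ∉ A) :
    Isotopic A f (fun x => ψ (f x)) := by
  obtain ⟨F, hF, hFt, hF0, hF1⟩ := hψ
  refine ⟨fun p => F (p.1, f p.2), hF.comp (contDiff_fst.prodMk (hfd.comp contDiff_snd)),
    fun t ht => ⟨?_, fun x hx => ?_⟩, fun x => hF0 _, fun x => hF1 _⟩
  · exact hf.comp hfd (hF.slice t) (hFt t ht).1.injOn fun x _ => (hFt t ht).2.1 _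
  · exact fun h => hfA x hx (((hFt t ht).2.2 _).1 h)

theorem Isotopic.symm {A : Set V} {f g : W → V} (h : Isotopic A f g) : Isotopic A g f := by
  obtain ⟨K, hK, hKt, h0, h1⟩ := h
  refine ⟨fun p => K (1 - p.1, p.2), hK.comp ((contDiff_const.sub contDiff_fst).prodMk
    contDiff_snd), fun t ht => hKt (1 - t) ⟨by linarith [ht.2], by linarith [ht.1]⟩, ?_, ?_⟩
  · intro x; simp [h1]
  · intro x; simp [h0]

theorem Isotopic.trans {A : Set V} {f g h : W → V} (h₁ : Isotopic A f g)
    (h₂ : Isotopic A g h) : Isotopic A f h := by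
  obtain ⟨K, hK, hKt, hK0, hK1⟩ := h₁
  obtain ⟨L, hL, hLt, hL0, hL1⟩ := h₂
  let a : ℝ → ℝ := fun t => Real.smoothTransition (3 * t)
  let b : ℝ → ℝ := fun t => Real.smoothTransition (3 * t - 2)
  have ha : ContDiff ℝ ∞ a := Real.smoothTransition.contDiff.comp (contDiff_const.mul contDiff_id)
  have hb : ContDiff ℝ ∞ b :=
    Real.smoothTransition.contDiff.comp ((contDiff_const.mul contDiff_id).sub contDiff_const)
  have hmem : ∀ t, Real.smoothTransition t ∈ Icc (0 : ℝ) 1 := fun t =>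
    ⟨Real.smoothTransition.nonneg t, Real.smoothTransition.le_one t⟩
  have hKs : ContDiff ℝ ∞ fun p : ℝ × W => K (a p.1, p.2) :=
    hK.comp ((ha.comp contDiff_fst).prodMk contDiff_snd)
  have hLs : ContDiff ℝ ∞ fun p : ℝ × W => L (b p.1, p.2) :=
    hL.comp ((hb.comp contDiff_fst).prodMk contDiff_snd)
  have hmidK : ∀ t, 1 / 3 ≤ t → ∀ x, K (a t, x) = g x := by
    intro t ht x
    have : a t = 1 := Real.smoothTransition.one_of_one_le (by linarith)
    rw [this, hK1]
  have hmidL : ∀ t, t ≤ 2 / 3 → ∀ x, L (b t, x) = g x := by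
    intro t ht x
    have : b t = 0 := Real.smoothTransition.zero_of_nonpos (by linarith)
    rw [this, hL0]
  refine ⟨fun p => if p.1 ≤ 1 / 2 then K (a p.1, p.2) else L (b p.1, p.2), ?_, ?_, ?_, ?_⟩
  · rw [contDiff_iff_contDiffAt]
    intro p
    rcases lt_or_ge p.1 (2 / 3) with hp | hp
    · refine hKs.contDiffAt.congr_of_eventuallyEq ?_
      filter_upwards [continuous_fst.continuousAt.eventually_lt_const hp] with q hq
      split_ifs with h
      · rfl
      · rw [hmidK _ (by linarith), hmidL _ hq.le]
    · refine hLs.contDiffAt.congr_of_eventuallyEq ?_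
      have hp' : 1 / 2 < p.1 := by linarith
      filter_upwards [continuous_fst.continuousAt.eventually_const_lt hp'] with q hq
      rw [if_neg (not_le.2 hq)]
  · intro t ht
    by_cases h : t ≤ 1 / 2
    · simpa only [h, if_true] using hKt (a t) (hmem _)
    · simpa only [h, if_false] using hLt (b t) (hmem _)
  · intro x
    have : a 0 = 0 := Real.smoothTransition.zero_of_nonpos (by simp)
    simp [this, hK0]
  · intro x
    have : b 1 = 1 := Real.smoothTransition.one_of_one_le (by norm_num)
    norm_num [this, hL1]

theorem Isotopic.map {V' : Type*} [NormedAddCommGroup V'] [NormedSpace ℝ V'] {A : Set V}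
    {A' : Set V'} {f g : W → V} (h : Isotopic A f g) {ψ : V → V'}
    (hψ : ContDiff ℝ ∞ ψ) (hi : Function.Injective ψ)
    (hd : ∀ z, Function.Injective (fderiv ℝ ψ z)) (hA : ∀ z, ψ z ∈ A' → z ∈ A) :
    Isotopic A' (fun x => ψ (f x)) (fun x => ψ (g x)) := by
  obtain ⟨K, hK, hKt, h0, h1⟩ := h
  refine ⟨fun p => ψ (K p), hψ.comp hK, fun t ht => ⟨?_, fun x hx hxA => ?_⟩, ?_, ?_⟩
  · exact (hKt t ht).1.comp (hK.slice t) hψ hi.injOn fun x _ => hd _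
  · exact (hKt t ht).2 x hx (hA _ hxA)
  · intro x; simp [h0]
  · intro x; simp [h1]

end Isotopy

section CoverDim

/-- `X` is covered by `O(2 ^ (n * d))` sets of diameter at most `2 ^ (-n)`, for every `n`. -/
def CoverDim {α : Type*} [PseudoMetricSpace α] (d : ℝ) (X : Set α) : Prop :=
  ∃ C : ℝ, ∀ n : ℕ, ∃ 𝒰 : Finset (Set α), (𝒰.card : ℝ) ≤ C * 2 ^ ((n : ℝ) * d) ∧
    (∀ x ∈ X, ∃ U ∈ 𝒰, x ∈ U) ∧ ∀ U ∈ 𝒰, ∀ x ∈ U, ∀ y ∈ U, dist x y ≤ ((2 : ℝ) ^ n)⁻¹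

variable {α β : Type*} [PseudoMetricSpace α] [PseudoMetricSpace β]

theorem CoverDim.mono {d : ℝ} {X Y : Set α} (h : CoverDim d Y) (hXY : X ⊆ Y) :
    CoverDim d X := by
  obtain ⟨C, hC⟩ := h
  refine ⟨C, fun n => ?_⟩
  obtain ⟨𝒰, h1, h2, h3⟩ := hC n
  exact ⟨𝒰, h1, fun x hx => h2 x (hXY hx), h3⟩

theorem CoverDim.mono_exp {d e : ℝ} {X : Set α} (h : CoverDim d X) (hde : d ≤ e) :
    CoverDim e X := by
  obtain ⟨C, hC⟩ := h
  refine ⟨|C|, fun n => ?_⟩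
  obtain ⟨𝒰, h1, h2, h3⟩ := hC n
  refine ⟨𝒰, h1.trans ?_, h2, h3⟩
  have : (2 : ℝ) ^ ((n : ℝ) * d) ≤ 2 ^ ((n : ℝ) * e) :=
    Real.rpow_le_rpow_of_exponent_le one_le_two (by gcongr)
  gcongr
  exact le_abs_self C

theorem CoverDim.union {d : ℝ} {X Y : Set α} (hX : CoverDim d X) (hY : CoverDim d Y) :
    CoverDim d (X ∪ Y) := by
  classical
  obtain ⟨C, hC⟩ := hX
  obtain ⟨C', hC'⟩ := hY
  refine ⟨C + C', fun n => ?_⟩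
  obtain ⟨𝒰, h1, h2, h3⟩ := hC n
  obtain ⟨𝒱, h1', h2', h3'⟩ := hC' n
  refine ⟨𝒰 ∪ 𝒱, ?_, ?_, ?_⟩
  · have : ((𝒰 ∪ 𝒱).card : ℝ) ≤ 𝒰.card + 𝒱.card := by exact_mod_cast Finset.card_union_le _ _
    linarith
  · rintro x (hx | hx)
    · obtain ⟨U, hU, hxU⟩ := h2 x hx
      exact ⟨U, Finset.mem_union_left _ hU, hxU⟩
    · obtain ⟨U, hU, hxU⟩ := h2' x hx
      exact ⟨U, Finset.mem_union_right _ hU, hxU⟩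
  · intro U hU
    rcases Finset.mem_union.1 hU with h | h
    · exact h3 U h
    · exact h3' U h

theorem CoverDim.image {d : ℝ} {X : Set α} (hX : CoverDim d X) {f : α → β} {L : NNReal}
    (hf : LipschitzOnWith L f X) : CoverDim d (f '' X) := by
  classical
  obtain ⟨C, hC⟩ := hX
  obtain ⟨k, hk⟩ := pow_unbounded_of_one_lt (L : ℝ) one_lt_two
  refine ⟨C * 2 ^ ((k : ℝ) * d), fun n => ?_⟩
  obtain ⟨𝒰, h1, h2, h3⟩ := hC (n + k)
  refine ⟨𝒰.image fun U => f '' (U ∩ X), ?_, ?_, ?_⟩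
  · calc ((𝒰.image fun U => f '' (U ∩ X)).card : ℝ) ≤ 𝒰.card := by
          exact_mod_cast Finset.card_image_le
      _ ≤ _ := h1
      _ = _ := by
          rw [mul_assoc, ← Real.rpow_add two_pos]
          push_cast
          ring_nf
  · rintro _ ⟨x, hx, rfl⟩
    obtain ⟨U, hU, hxU⟩ := h2 x hx
    exact ⟨_, Finset.mem_image_of_mem _ hU, ⟨x, ⟨hxU, hx⟩, rfl⟩⟩
  · intro U' hU'
    obtain ⟨U, hU, rfl⟩ := Finset.mem_image.1 hU'
    rintro _ ⟨x, ⟨hx, hxX⟩, rfl⟩ _ ⟨y, ⟨hy, hyX⟩, rfl⟩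
    calc dist (f x) (f y) ≤ L * dist x y := hf.dist_le_mul x hxX y hyX
      _ ≤ 2 ^ k * ((2 : ℝ) ^ (n + k))⁻¹ := by
          gcongr
          exact h3 U hU x hx y hy
      _ = ((2 : ℝ) ^ n)⁻¹ := by
          rw [pow_add]
          field_simp

theorem CoverDim.prod {d e : ℝ} {X : Set α} {Y : Set β} (hX : CoverDim d X)
    (hY : CoverDim e Y) : CoverDim (d + e) (X ×ˢ Y) := by
  classical
  obtain ⟨C, hC⟩ := hX
  obtain ⟨C', hC'⟩ := hY
  refine ⟨C * C', fun n => ?_⟩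
  obtain ⟨𝒰, h1, h2, h3⟩ := hC n
  obtain ⟨𝒱, h1', h2', h3'⟩ := hC' n
  refine ⟨(𝒰 ×ˢ 𝒱).image fun p => p.1 ×ˢ p.2, ?_, ?_, ?_⟩
  · calc (((𝒰 ×ˢ 𝒱).image fun p => p.1 ×ˢ p.2).card : ℝ) ≤ (𝒰 ×ˢ 𝒱).card := by
          exact_mod_cast Finset.card_image_le
      _ = 𝒰.card * 𝒱.card := by rw [Finset.card_product]; push_cast; rfl
      _ ≤ (C * 2 ^ ((n : ℝ) * d)) * (C' * 2 ^ ((n : ℝ) * e)) := by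
        gcongr
        exact (Nat.cast_nonneg 𝒰.card).trans h1
      _ = _ := by rw [mul_add, Real.rpow_add two_pos]; ring
  · rintro ⟨x, y⟩ ⟨hx, hy⟩
    obtain ⟨U, hU, hxU⟩ := h2 x hx
    obtain ⟨U', hU', hyU⟩ := h2' y hy
    exact ⟨_, Finset.mem_image_of_mem _ (Finset.mk_mem_product hU hU'), hxU, hyU⟩
  · intro U' hU'
    obtain ⟨⟨U, U''⟩, hU, rfl⟩ := Finset.mem_image.1 hU'
    rw [Finset.mem_product] at hU
    rintro ⟨x, y⟩ ⟨hx, hy⟩ ⟨x', y'⟩ ⟨hx', hy'⟩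
    exact max_le (h3 U hU.1 x hx x' hx') (h3' U'' hU.2 y hy y' hy')

theorem CoverDim.eq_empty {d : ℝ} {X : Set α} (hX : CoverDim d X) (hd : d < 0) : X = ∅ := by
  obtain ⟨C, hC⟩ := hX
  by_contra hne
  obtain ⟨x, hx⟩ := nonempty_iff_ne_empty.2 hne
  have hone : ∀ n : ℕ, (1 : ℝ) ≤ C * ((2 : ℝ) ^ d) ^ n := by
    intro n
    obtain ⟨𝒰, h1, h2, -⟩ := hC n
    obtain ⟨U, hU, -⟩ := h2 x hx
    have : 1 ≤ 𝒰.card := Finset.card_pos.2 ⟨U, hU⟩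
    rw [← Real.rpow_natCast, ← Real.rpow_mul two_pos.le, mul_comm d]
    exact (by exact_mod_cast this : (1 : ℝ) ≤ 𝒰.card).trans h1
  have hlim : Filter.Tendsto (fun n : ℕ => C * ((2 : ℝ) ^ d) ^ n) Filter.atTop (𝓝 (C * 0)) :=
    (tendsto_pow_atTop_nhds_zero_of_lt_one (by positivity)
      (Real.rpow_lt_one_of_one_lt_of_neg one_lt_two hd)).const_mul C
  have := ge_of_tendsto' hlim hone
  norm_num at this

theorem coverDim_pi_closedBall (ι : Type*) [Fintype ι] (R : ℝ) :
    CoverDim (Fintype.card ι) (closedBall (0 : ι → ℝ) R) := by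
  classical
  obtain ⟨M, hM⟩ := exists_nat_ge R
  refine ⟨(2 * M + 3) ^ Fintype.card ι, fun n => ?_⟩
  let Z : Finset ℤ := Finset.Icc (-(M * 2 ^ n)) (M * 2 ^ n)
  let box : (ι → ℤ) → Set (ι → ℝ) := fun k => {x | ∀ i, ⌊(2 : ℝ) ^ n * x i⌋ = k i}
  have hpow : (0 : ℝ) < 2 ^ n := by positivity
  refine ⟨(Fintype.piFinset fun _ => Z).image box, ?_, ?_, ?_⟩
  · calc (((Fintype.piFinset fun _ : ι => Z).image box).card : ℝ)
        ≤ (Fintype.piFinset fun _ : ι => Z).card := by exact_mod_cast Finset.card_image_le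
      _ = (Z.card : ℝ) ^ Fintype.card ι := by simp
      _ ≤ ((2 * M + 3) * 2 ^ n) ^ Fintype.card ι := by
          gcongr
          have : Z.card = 2 * M * 2 ^ n + 1 := by
            simp only [Z, Int.card_Icc]
            have : (0 : ℤ) ≤ M * 2 ^ n := by positivity
            zify
            rw [Int.toNat_of_nonneg (by linarith)]
            ring
          rw [this]
          push_cast
          have : (1 : ℝ) ≤ 2 ^ n := one_le_pow₀ one_le_two
          nlinarith
      _ = _ := by
          rw [mul_pow, ← Real.rpow_natCast (2 ^ n), ← Real.rpow_natCast 2 n,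
            ← Real.rpow_mul two_pos.le]
  · intro x hx
    refine ⟨box fun i => ⌊(2 : ℝ) ^ n * x i⌋, Finset.mem_image_of_mem _ ?_, fun i => rfl⟩
    rw [Fintype.mem_piFinset]
    intro i
    have h1 : |x i| ≤ M := by
      rw [← Real.norm_eq_abs]
      exact (norm_le_pi_norm x i).trans ((mem_closedBall_zero_iff.1 hx).trans hM)
    rw [abs_le] at h1
    rw [Finset.mem_Icc]
    constructor
    · rw [Int.le_floor]
      push_cast
      nlinarith
    · have h2 : (⌊(2 : ℝ) ^ n * x i⌋ : ℝ) ≤ ((M * 2 ^ n : ℤ) : ℝ) := by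
        push_cast
        exact (Int.floor_le _).trans (by nlinarith)
      exact_mod_cast h2
  · intro U hU
    obtain ⟨k, -, rfl⟩ := Finset.mem_image.1 hU
    intro x hx y hy
    rw [dist_pi_le_iff (by positivity)]
    intro i
    have h1 := Int.abs_sub_lt_one_of_floor_eq_floor ((hx i).trans (hy i).symm)
    rw [← mul_sub, abs_mul, abs_of_pos hpow] at h1
    rw [Real.dist_eq, ← one_div, le_div_iff₀ hpow, mul_comm]
    exact h1.le

theorem ContDiff.exists_lipschitzOnWith {E E' : Type*} [NormedAddCommGroup E]
    [NormedSpace ℝ E] [FiniteDimensional ℝ E] [NormedAddCommGroup E'] [NormedSpace ℝ E']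
    {f : E → E'} (hf : ContDiff ℝ ∞ f) {X : Set E} (hX : Bornology.IsBounded X) :
    ∃ L : NNReal, LipschitzOnWith L f X := by
  obtain ⟨R, hR⟩ := hX.subset_closedBall (0 : E)
  have := FiniteDimensional.proper ℝ E
  obtain ⟨C, hC⟩ := (isCompact_closedBall (0 : E) R).exists_bound_of_continuousOn
    (hf.continuous_fderiv (by simp)).continuousOn
  refine ⟨Real.toNNReal |C|, LipschitzOnWith.mono ?_ hR⟩
  refine Convex.lipschitzOnWith_of_nnnorm_fderiv_le (𝕜 := ℝ) (fun x _ => hf.dif x)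
    (fun x hx => ?_) (convex_closedBall _ _)
  rw [← NNReal.coe_le_coe, Real.coe_toNNReal _ (abs_nonneg C), coe_nnnorm]
  exact (hC x hx).trans (le_abs_self C)

theorem CoverDim.image_contDiff {E E' : Type*} [NormedAddCommGroup E]
    [NormedSpace ℝ E] [FiniteDimensional ℝ E] [NormedAddCommGroup E'] [NormedSpace ℝ E']
    {d : ℝ} {X : Set E} (h : CoverDim d X) (hX : Bornology.IsBounded X) {f : E → E'}
    (hf : ContDiff ℝ ∞ f) : CoverDim d (f '' X) := by
  obtain ⟨L, hL⟩ := hf.exists_lipschitzOnWith hX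
  exact h.image hL

theorem coverDim_of_isBounded {E : Type*} [NormedAddCommGroup E] [NormedSpace ℝ E]
    [FiniteDimensional ℝ E] {X : Set E} (hX : Bornology.IsBounded X) :
    CoverDim (Module.finrank ℝ E) X := by
  let e : E ≃L[ℝ] (Fin (Module.finrank ℝ E) → ℝ) :=
    ContinuousLinearEquiv.ofFinrankEq (by simp)
  have h1 : Bornology.IsBounded (e '' X) := e.lipschitz.isBounded_image hX
  obtain ⟨R, hR⟩ := h1.subset_closedBall 0
  have h2 := (coverDim_pi_closedBall (Fin (Module.finrank ℝ E)) R).mono hR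
  rw [Fintype.card_fin] at h2
  have h3 := h2.image (e.symm.lipschitz.lipschitzOnWith (s := e '' X))
  rwa [← image_comp, e.symm_comp_self, image_id] at h3

open MeasureTheory in
/-- Almost every fibre of a Lipschitz map to `V` loses `dim V` dimensions. -/
theorem CoverDim.ae_fiber {V : Type*} [NormedAddCommGroup V] [NormedSpace ℝ V]
    [FiniteDimensional ℝ V] [MeasurableSpace V] [BorelSpace V] (μ : Measure V)
    [μ.IsAddHaarMeasure] {D : ℝ} {Y : Set α} (hY : CoverDim D Y) {m : α → V} {L : NNReal}
    (hm : LipschitzOnWith L m Y) {η : ℝ} (hη : 0 < η) :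
    ∀ᵐ v ∂μ, CoverDim (D - Module.finrank ℝ V + η) (Y ∩ m ⁻¹' {v}) := by
  classical
  obtain ⟨C, hC⟩ := hY
  choose 𝒰 h1 h2 h3 using hC
  set k := Module.finrank ℝ V with hk
  have hex : ∀ n : ℕ, ∀ U : Set α, ∃ B : Set V, U ∈ 𝒰 n → (MeasurableSet B ∧
      (∀ x ∈ U, x ∈ Y → m x ∈ B) ∧
      μ B ≤ ENNReal.ofReal ((L * ((2 : ℝ) ^ n)⁻¹) ^ k) * μ (ball 0 1)) := by
    intro n U
    by_cases hU : U ∈ 𝒰 n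
    · by_cases hne : ∃ x ∈ U, x ∈ Y
      · obtain ⟨x, hxU, hxY⟩ := hne
        refine ⟨closedBall (m x) (L * ((2 : ℝ) ^ n)⁻¹), fun _ => ⟨measurableSet_closedBall,
          fun y hy hyY => ?_, (μ.addHaar_closedBall _ (by positivity)).le⟩⟩
        exact (hm.dist_le_mul y hyY x hxY).trans (by gcongr; exact h3 n U hU y hy x hxU)
      · push Not at hne
        exact ⟨∅, fun _ => ⟨MeasurableSet.empty, fun x hx hxY => (hne x hx hxY).elim, by simp⟩⟩
    · exact ⟨∅, fun h => (hU h).elim⟩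
  choose B hB using hex
  let c : ℕ → ENNReal := fun n => ENNReal.ofReal (2 ^ (-((n : ℝ) * (D - k + η))))
  let f : V → ENNReal := fun v =>
    ∑' n, ∑ U ∈ 𝒰 n, c n * (B n U).indicator 1 v
  have hmeas : ∀ n, ∀ U ∈ 𝒰 n, Measurable fun v => c n * (B n U).indicator (1 : V → ENNReal) v :=
    fun n U hU => (measurable_one.indicator (hB n U hU).1).const_mul _
  have hmeas' : ∀ n, Measurable fun v => ∑ U ∈ 𝒰 n, c n * (B n U).indicator (1 : V → ENNReal) v :=
    fun n => Finset.measurable_fun_sum _ (hmeas n)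
  have hfm : Measurable f := Measurable.tsum hmeas'
  have hterm : ∀ n, ∫⁻ v, ∑ U ∈ 𝒰 n, c n * (B n U).indicator (1 : V → ENNReal) v ∂μ ≤
      ENNReal.ofReal (|C| * L ^ k) * μ (ball 0 1) * ENNReal.ofReal ((2 : ℝ) ^ (-η)) ^ n := by
    intro n
    rw [lintegral_finsetSum' _ fun U hU => (hmeas n U hU).aemeasurable]
    calc ∑ U ∈ 𝒰 n, ∫⁻ v, c n * (B n U).indicator (1 : V → ENNReal) v ∂μ
        ≤ ∑ U ∈ 𝒰 n, c n * (ENNReal.ofReal ((L * ((2 : ℝ) ^ n)⁻¹) ^ k) * μ (ball 0 1)) := by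
          refine Finset.sum_le_sum fun U hU => ?_
          rw [lintegral_const_mul _ (measurable_one.indicator (hB n U hU).1),
            lintegral_indicator_one (hB n U hU).1]
          gcongr
          exact (hB n U hU).2.2
      _ = ENNReal.ofReal ((𝒰 n).card * 2 ^ (-((n : ℝ) * (D - k + η))) *
            (L * ((2 : ℝ) ^ n)⁻¹) ^ k) * μ (ball 0 1) := by
          rw [Finset.sum_const, nsmul_eq_mul, ← mul_assoc, ← mul_assoc,
            ENNReal.ofReal_mul (by positivity), ENNReal.ofReal_mul (by positivity),
            ENNReal.ofReal_natCast]
      _ ≤ ENNReal.ofReal ((|C| * L ^ k) * ((2 : ℝ) ^ (-η)) ^ n) * μ (ball 0 1) := by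
          gcongr ENNReal.ofReal ?_ * _
          have h4 : ((𝒰 n).card : ℝ) ≤ |C| * 2 ^ ((n : ℝ) * D) :=
            (h1 n).trans (by gcongr; exact le_abs_self C)
          calc ((𝒰 n).card : ℝ) * 2 ^ (-((n : ℝ) * (D - k + η))) * (L * ((2 : ℝ) ^ n)⁻¹) ^ k
              ≤ (|C| * 2 ^ ((n : ℝ) * D)) * 2 ^ (-((n : ℝ) * (D - k + η))) *
                (L * ((2 : ℝ) ^ n)⁻¹) ^ k := by gcongr
            _ = (|C| * L ^ k) * (2 ^ ((n : ℝ) * D) * 2 ^ (-((n : ℝ) * (D - k + η))) *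
                2 ^ (-((n : ℝ) * k))) := by
                have : (((2 : ℝ) ^ n)⁻¹) ^ k = 2 ^ (-((n : ℝ) * k)) := by
                  rw [Real.rpow_neg two_pos.le, Real.rpow_mul two_pos.le, Real.rpow_natCast,
                    Real.rpow_natCast, inv_pow]
                rw [mul_pow, this]
                ring
            _ = _ := by
                rw [← Real.rpow_add two_pos, ← Real.rpow_add two_pos,
                  ← Real.rpow_natCast ((2 : ℝ) ^ (-η)) n, ← Real.rpow_mul two_pos.le]
                ring_nf
      _ = _ := by
          rw [ENNReal.ofReal_mul (by positivity), ENNReal.ofReal_pow (by positivity)]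
          ring
  have hne_top : ∫⁻ v, f v ∂μ ≠ ⊤ := by
    rw [lintegral_tsum fun n => (hmeas' n).aemeasurable]
    refine ne_top_of_le_ne_top ?_ (ENNReal.tsum_le_tsum hterm)
    rw [ENNReal.tsum_mul_left, ENNReal.tsum_geometric]
    refine ENNReal.mul_ne_top (ENNReal.mul_ne_top ENNReal.ofReal_ne_top
      measure_ball_lt_top.ne) ?_
    rw [ENNReal.inv_ne_top]
    refine (tsub_pos_of_lt ?_).ne'
    rw [ENNReal.ofReal_lt_one]
    exact Real.rpow_lt_one_of_one_lt_of_neg one_lt_two (by linarith)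
  filter_upwards [ae_lt_top hfm hne_top] with v hv
  refine ⟨(f v).toReal, fun n => ⟨(𝒰 n).filter fun U => v ∈ B n U, ?_, ?_, ?_⟩⟩
  · have h5 : (((𝒰 n).filter fun U => v ∈ B n U).card : ENNReal) * c n ≤ f v := by
      refine le_trans (le_of_eq ?_) (ENNReal.le_tsum n)
      rw [← Finset.sum_filter_add_sum_filter_not (𝒰 n) fun U => v ∈ B n U,
        Finset.sum_congr rfl fun U hU => by
          rw [indicator_of_mem (Finset.mem_filter.1 hU).2, Pi.one_apply, mul_one],
        Finset.sum_eq_zero (s := (𝒰 n).filter fun U => v ∉ B n U) fun U hU => by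
          rw [indicator_of_notMem (Finset.mem_filter.1 hU).2, mul_zero]]
      simp
    have h6 := ENNReal.toReal_mono hv.ne h5
    rw [ENNReal.toReal_mul, ENNReal.toReal_natCast, ENNReal.toReal_ofReal (by positivity),
      Real.rpow_neg two_pos.le] at h6
    rwa [← div_eq_mul_inv, div_le_iff₀ (by positivity)] at h6
  · rintro x ⟨hxY, hxv⟩
    obtain ⟨U, hU, hxU⟩ := h2 n x hxY
    refine ⟨U, Finset.mem_filter.2 ⟨hU, ?_⟩, hxU⟩
    rw [← show m x = v from hxv]
    exact (hB n U hU).2.1 x hxU hxY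
  · intro U hU
    exact h3 n U (Finset.mem_filter.1 hU).1

end CoverDim

section LeftInverse

/-- The inverse function theorem, with a smooth inverse on the whole target. -/
theorem ContDiff.exists_openPartialHomeomorph {X Y : Type*} [NormedAddCommGroup X]
    [NormedSpace ℝ X] [CompleteSpace X] [NormedAddCommGroup Y] [NormedSpace ℝ Y] {f : X → Y}
    (hf : ContDiff ℝ ∞ f) {x₀ : X} {f' : X ≃L[ℝ] Y} (h : HasFDerivAt f (f' : X →L[ℝ] Y) x₀) :
    ∃ e : OpenPartialHomeomorph X Y, x₀ ∈ e.source ∧ (∀ x, e x = f x) ∧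
      ContDiffOn ℝ ∞ e.symm e.target := by
  let e := hf.contDiffAt.toOpenPartialHomeomorph f h (by simp)
  have hs : IsOpen {x | fderiv ℝ f x ∈ range ((↑) : (X ≃L[ℝ] Y) → X →L[ℝ] Y)} :=
    ContinuousLinearEquiv.isOpen.preimage (hf.continuous_fderiv (by simp))
  refine ⟨e.restrOpen _ hs, ⟨hf.contDiffAt.mem_toOpenPartialHomeomorph_source h (by simp),
    f', h.fderiv.symm⟩, fun x => rfl, fun y hy => ?_⟩
  have hy' : y ∈ e.target ∩ e.symm ⁻¹'
      {x | fderiv ℝ f x ∈ range ((↑) : (X ≃L[ℝ] Y) → X →L[ℝ] Y)} := hy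
  obtain ⟨A, hA⟩ := hy'.2
  refine (e.contDiffAt_symm hy'.1 (f₀' := A) ?_ hf.contDiffAt).contDiffWithinAt
  rw [hA]
  exact (hf.dif _).hasFDerivAt

variable {W V : Type*} [NormedAddCommGroup W] [InnerProductSpace ℝ W] [FiniteDimensional ℝ W]
  [NormedAddCommGroup V] [NormedSpace ℝ V] [FiniteDimensional ℝ V]

theorem SphereEmb.exists_local_leftInverse {g : W → V} (hgs : ContDiff ℝ ∞ g)
    (hg : SphereEmb g) {x₀ : W} (hx₀ : x₀ ∈ sphere (0 : W) 1) :
    ∃ U ∈ 𝓝 (g x₀), ∃ c : V → W, ContDiffOn ℝ ∞ c U ∧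
      ∀ x ∈ sphere (0 : W) 1, g x ∈ U → c (g x) = x := by
  let J : W → V × ℝ := fun x => (g x, ‖x‖ ^ 2)
  have hJ : ContDiff ℝ ∞ J := hgs.prodMk (contDiff_norm_sq ℝ)
  have hJd : HasFDerivAt J ((fderiv ℝ g x₀).prod (2 • (innerSL ℝ x₀))) x₀ :=
    (hgs.dif x₀).hasFDerivAt.prodMk (hasStrictFDerivAt_norm_sq x₀).hasFDerivAt
  have hker : (((fderiv ℝ g x₀).prod (2 • (innerSL ℝ x₀)) : W →L[ℝ] V × ℝ) :
      W →ₗ[ℝ] V × ℝ).ker = ⊥ := by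
    rw [LinearMap.ker_eq_bot']
    intro u hu
    have h1 : fderiv ℝ g x₀ u = 0 := congrArg Prod.fst hu
    have h2 : 2 • inner ℝ x₀ u = (0 : ℝ) := congrArg Prod.snd hu
    exact hg.2 x₀ hx₀ u (by simpa using h2) h1
  obtain ⟨T, hT⟩ := LinearMap.exists_leftInverse_of_injective _ hker
  let T' : V × ℝ →L[ℝ] W := LinearMap.toContinuousLinearMap T
  have hid : HasFDerivAt (fun x => T' (J x)) (ContinuousLinearEquiv.refl ℝ W : W →L[ℝ] W) x₀ := by
    have h1 : HasFDerivAt (fun x => T' (J x)) _ x₀ := T'.hasFDerivAt.comp x₀ hJd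
    convert h1 using 1
    ext u
    exact (LinearMap.congr_fun hT u).symm
  obtain ⟨e, hes, hee, hesm⟩ :=
    (T'.contDiff.comp hJ : ContDiff ℝ ∞ fun x => T' (J x)).exists_openPartialHomeomorph hid
  let q : V → W := fun w => T' (w, 1)
  have hq : ContDiff ℝ ∞ q := T'.contDiff.comp (contDiff_id.prodMk contDiff_const)
  have hqg : ∀ x ∈ sphere (0 : W) 1, q (g x) = e x := by
    intro x hx
    rw [hee]
    simp [q, J, mem_sphere_zero_iff_norm.1 hx]
  have hcpt : IsCompact (g '' (sphere (0 : W) 1 \ e.source)) :=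
    ((isCompact_sphere _ _).diff e.open_source).image hgs.continuous
  have hnot : g x₀ ∉ g '' (sphere (0 : W) 1 \ e.source) := by
    rintro ⟨x, ⟨hx, hxe⟩, hxx⟩
    exact hxe (hg.1 hx hx₀ hxx ▸ hes)
  refine ⟨q ⁻¹' e.target ∩ (g '' (sphere (0 : W) 1 \ e.source))ᶜ, Filter.inter_mem ?_
    (hcpt.isClosed.isOpen_compl.mem_nhds hnot), fun w => e.symm (q w),
    (hesm.comp hq.contDiffOn inter_subset_left), fun x hx hxU => ?_⟩
  · refine hq.continuous.continuousAt.preimage_mem_nhds (e.open_target.mem_nhds ?_)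
    rw [hqg x₀ hx₀]
    exact e.map_source hes
  · have : x ∈ e.source := by
      by_contra hxe
      exact hxU.2 ⟨x, ⟨hx, hxe⟩, rfl⟩
    change e.symm (q (g x)) = x
    rw [hqg x hx, e.left_inv this]

/-- An embedded sphere has a globally defined smooth left inverse. -/
theorem SphereEmb.exists_leftInverse {g : W → V} (hgs : ContDiff ℝ ∞ g) (hg : SphereEmb g) :
    ∃ c : V → W, ContDiff ℝ ∞ c ∧ ∀ x ∈ sphere (0 : W) 1, c (g x) = x := by
  let t : V → Set W := fun w => {y : W | ∀ x ∈ sphere (0 : W) 1, g x = w → y = x}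
  have hconv : ∀ w, Convex ℝ (t w) := by
    intro w y hy z hz a b _ _ hab x hx hxw
    rw [hy x hx hxw, hz x hx hxw, ← add_smul, hab, one_smul]
  have hloc : ∀ w, ∃ U ∈ 𝓝 w, ∃ c : V → W,
      ContMDiffOn 𝓘(ℝ, V) 𝓘(ℝ, W) (⊤ : ℕ∞) c U ∧ ∀ y ∈ U, c y ∈ t y := by
    intro w
    by_cases hw : w ∈ g '' sphere (0 : W) 1
    · obtain ⟨x₀, hx₀, rfl⟩ := hw
      obtain ⟨U, hU, c, hc, hcU⟩ := hg.exists_local_leftInverse hgs hx₀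
      exact ⟨U, hU, c, hc.contMDiffOn, fun y hy x hx hxy => by subst hxy; exact hcU x hx hy⟩
    · refine ⟨(g '' sphere (0 : W) 1)ᶜ,
        ((isCompact_sphere _ _).image hgs.continuous).isClosed.isOpen_compl.mem_nhds hw,
        fun _ => 0, contMDiffOn_const, fun y hy x hx hxy => (hy ⟨x, hx, hxy⟩).elim⟩
  obtain ⟨c, hc⟩ := exists_contMDiffMap_forall_mem_convex_of_local 𝓘(ℝ, V) hconv hloc
  exact ⟨c, c.contMDiff.contDiff, fun x hx => hc (g x) x hx rfl⟩

end LeftInverse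

section Boost

variable {W V : Type*} [NormedAddCommGroup W] [InnerProductSpace ℝ W]
  [NormedAddCommGroup V] [NormedSpace ℝ V]

theorem half_le_norm_add_smul {e x : W} (he : ‖e‖ = 1) (hx : ‖x‖ = 1) {t : ℝ}
    (ht : t ∈ Icc (0 : ℝ) (1 / 2)) : 1 / 2 ≤ ‖x + t • e‖ := by
  have h1 : ‖x‖ ≤ ‖x + t • e‖ + ‖t • e‖ := by simpa using norm_sub_le (x + t • e) (t • e)
  rw [hx, norm_smul, he, Real.norm_eq_abs, abs_of_nonneg ht.1] at h1
  linarith [ht.2]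

/-- The map pushing points of the unit sphere towards `e`. -/
noncomputable def boost (e : W) (t : ℝ) (x : W) : W := ‖x + t • e‖⁻¹ • (x + t • e)

theorem norm_boost {e x : W} (he : ‖e‖ = 1) (hx : ‖x‖ = 1) {t : ℝ}
    (ht : t ∈ Icc (0 : ℝ) (1 / 2)) : ‖boost e t x‖ = 1 := by
  have := half_le_norm_add_smul he hx ht
  rw [boost, norm_smul, norm_inv, norm_norm, inv_mul_cancel₀]
  linarith

theorem exists_boost_eq {e y : W} (he : ‖e‖ = 1) (hy : ‖y‖ = 1) {t : ℝ}
    (ht : t ∈ Icc (0 : ℝ) (1 / 2)) : ∃ x : W, ‖x‖ = 1 ∧ boost e t x = y := by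
  have hc : ContinuousOn (fun l : ℝ => ‖l • y - t • e‖) (Icc 0 2) := by fun_prop
  have hmem : (1 : ℝ) ∈ Icc ‖(0 : ℝ) • y - t • e‖ ‖(2 : ℝ) • y - t • e‖ := by
    have h1 : ‖t • e‖ = t := by rw [norm_smul, he, Real.norm_eq_abs, abs_of_nonneg ht.1, mul_one]
    have h2 : ‖(2 : ℝ) • y‖ = 2 := by rw [norm_smul, hy]; simp
    have h3 := norm_sub_norm_le ((2 : ℝ) • y) (t • e)
    constructor
    · rw [zero_smul, zero_sub, norm_neg, h1]; linarith [ht.2]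
    · rw [h1, h2] at h3; linarith [ht.2]
  obtain ⟨l, hl, hl1⟩ := intermediate_value_Icc (by norm_num) hc hmem
  have hl0 : 0 < l := by
    refine lt_of_le_of_ne hl.1 fun h => ?_
    have hl1' : ‖l • y - t • e‖ = 1 := hl1
    rw [← h, zero_smul, zero_sub, norm_neg, norm_smul, he, Real.norm_eq_abs,
      abs_of_nonneg ht.1] at hl1'
    linarith [ht.2]
  refine ⟨l • y - t • e, hl1, ?_⟩
  rw [boost, sub_add_cancel, norm_smul, hy, mul_one, Real.norm_eq_abs, abs_of_pos hl0, smul_smul,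
    inv_mul_cancel₀ hl0.ne', one_smul]

theorem boost_ratio {e x : W} (he : ‖e‖ = 1) (hx : ‖x‖ = 1) {t : ℝ}
    (ht : t ∈ Icc (0 : ℝ) (1 / 2)) :
    (1 - inner ℝ (boost e t x) e) * ((1 + inner ℝ x e) * (1 + t) ^ 2) ≤
      (1 - inner ℝ x e) * (1 + inner ℝ (boost e t x) e) := by
  set m := inner ℝ x e with hm
  set s := ‖x + t • e‖ with hs
  have hs2 := half_le_norm_add_smul he hx ht
  have hs0 : 0 < s := by linarith
  have hsq : s ^ 2 = 1 + 2 * t * m + t ^ 2 := by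
    rw [hs, norm_add_sq_real, hx, norm_smul, he, inner_smul_right, ← hm, Real.norm_eq_abs,
      mul_one, sq_abs]
    ring
  have hb : inner ℝ (boost e t x) e = (m + t) / s := by
    rw [boost, inner_smul_left, inner_add_left, inner_smul_left, real_inner_self_eq_norm_sq, he,
      ← hm, ← hs]
    simp
    field_simp
  have hmabs : |m| ≤ 1 := by
    have := abs_real_inner_le_norm x e
    rwa [hx, he, mul_one] at this
  obtain ⟨hm1, hm2⟩ := abs_le.1 hmabs
  have hsm : 1 + t * m ≤ s := by
    nlinarith [ht.1, ht.2, sq_nonneg (s - (1 + t * m)), mul_nonneg (sq_nonneg t)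
      (by nlinarith : 0 ≤ 1 - m ^ 2)]
  have hsum : (1 + m) * (1 + t) ≤ s + m + t := by nlinarith
  have hprod : (s - m - t) * (s + m + t) = (1 - m) * (1 + m) := by nlinarith
  have key : (s - m - t) * ((1 + m) * (1 + t) ^ 2) ≤ (1 - m) * (s + m + t) := by
    rcases eq_or_lt_of_le (show 0 ≤ s + m + t by nlinarith [ht.1]) with h0 | h0
    · have : 1 + m = 0 := by nlinarith [ht.1]
      rw [this, ← h0]; simp
    · have h1 : (s - m - t) * ((1 + m) * (1 + t) ^ 2) * (s + m + t) ≤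
          (1 - m) * (s + m + t) * (s + m + t) := by
        have h2 : ((1 + m) * (1 + t)) ^ 2 ≤ (s + m + t) ^ 2 :=
          pow_le_pow_left₀ (by nlinarith [ht.1]) hsum 2
        calc (s - m - t) * ((1 + m) * (1 + t) ^ 2) * (s + m + t)
            = (1 - m) * ((1 + m) * (1 + t)) ^ 2 := by
              linear_combination ((1 + m) * (1 + t) ^ 2) * hprod
          _ ≤ (1 - m) * (s + m + t) ^ 2 := by
              gcongr
          _ = _ := by ring
      exact le_of_mul_le_mul_right h1 h0
  rw [hb]
  have e1 : 1 - (m + t) / s = (s - m - t) / s := by field_simp; ring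
  have e2 : 1 + (m + t) / s = (s + m + t) / s := by field_simp; ring
  rw [e1, e2, div_mul_eq_mul_div, mul_div_assoc', div_le_div_iff_of_pos_right hs0]
  exact key

theorem norm_boost_iterate {e x : W} (he : ‖e‖ = 1) (hx : ‖x‖ = 1) {t : ℝ}
    (ht : t ∈ Icc (0 : ℝ) (1 / 2)) (n : ℕ) : ‖(boost e t)^[n] x‖ = 1 := by
  induction n with
  | zero => exact hx
  | succ n ih => rw [Function.iterate_succ_apply']; exact norm_boost he ih ht

theorem boost_iterate_ratio {e x : W} (he : ‖e‖ = 1) (hx : ‖x‖ = 1) {t : ℝ}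
    (ht : t ∈ Icc (0 : ℝ) (1 / 2)) (n : ℕ) :
    (1 - inner ℝ ((boost e t)^[n] x) e) * ((1 + inner ℝ x e) * ((1 + t) ^ 2) ^ n) ≤ 4 := by
  have hm : ∀ y : W, ‖y‖ = 1 → |inner ℝ y e| ≤ 1 := by
    intro y hy
    have := abs_real_inner_le_norm y e
    rwa [hy, he, mul_one] at this
  have main : ∀ n : ℕ, (1 - inner ℝ ((boost e t)^[n] x) e) *
      ((1 + inner ℝ x e) * ((1 + t) ^ 2) ^ n) ≤
      (1 - inner ℝ x e) * (1 + inner ℝ ((boost e t)^[n] x) e) := by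
    intro n
    induction n with
    | zero => simp only [Function.iterate_zero, id_eq, pow_zero]; linarith
    | succ n ih =>
      have h1 := boost_ratio he (norm_boost_iterate he hx ht n) ht
      rw [← Function.iterate_succ_apply' (boost e t)] at h1
      set a := inner ℝ ((boost e t)^[n] x) e with ha
      set b := inner ℝ ((boost e t)^[n + 1] x) e with hb
      set m := inner ℝ x e
      have ha' := abs_le.1 (hm _ (norm_boost_iterate he hx ht n))
      have hb' := abs_le.1 (hm _ (norm_boost_iterate he hx ht (n + 1)))
      have hm' := abs_le.1 (hm x hx)
      rw [← ha] at ha'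
      rw [← hb] at hb'
      set q := (1 + t) ^ 2
      have hq : 1 ≤ q := one_le_pow₀ (by linarith [ht.1])
      rcases eq_or_lt_of_le (show 0 ≤ 1 + a by linarith) with h0 | h0
      · have h2 : (1 + m) * q ^ n ≤ 0 := by nlinarith
        have h3 : 1 + m ≤ 0 := by
          by_contra h
          exact absurd h2 (not_le.2 (mul_pos (not_le.1 h) (by positivity)))
        have h4 : 1 + m = 0 := le_antisymm h3 (by linarith)
        rw [h4, zero_mul, mul_zero]
        exact mul_nonneg (by linarith) (by linarith)
      · have h2 : (1 - b) * ((1 + m) * q ^ (n + 1)) * (1 + a) ≤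
            (1 - m) * (1 + b) * (1 + a) := by
          calc (1 - b) * ((1 + m) * q ^ (n + 1)) * (1 + a)
              = ((1 - b) * ((1 + a) * q)) * ((1 + m) * q ^ n) := by ring
            _ ≤ ((1 - a) * (1 + b)) * ((1 + m) * q ^ n) := by
                refine mul_le_mul_of_nonneg_right h1 (mul_nonneg (by linarith) (by positivity))
            _ = (1 + b) * ((1 - a) * ((1 + m) * q ^ n)) := by ring
            _ ≤ (1 + b) * ((1 - m) * (1 + a)) := by
                refine mul_le_mul_of_nonneg_left ih (by linarith)
            _ = _ := by ring
        exact le_of_mul_le_mul_right h2 h0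
  refine (main n).trans ?_
  have h1 := abs_le.1 (hm x hx)
  have h2 := abs_le.1 (hm _ (norm_boost_iterate he hx ht n))
  nlinarith

theorem exists_boost_iterate_close {e : W} (he : ‖e‖ = 1) {C : Set W} (hC : IsCompact C)
    (hCs : C ⊆ sphere 0 1) (hne : -e ∉ C) {t : ℝ} (ht : t ∈ Icc (0 : ℝ) (1 / 2)) (ht0 : 0 < t)
    {ε : ℝ} (hε : 0 < ε) : ∃ n : ℕ, ∀ x ∈ C, ‖(boost e t)^[n] x - e‖ < ε := by
  obtain ⟨c, hc0, hc⟩ : ∃ c : ℝ, 0 < c ∧ ∀ x ∈ C, c ≤ 1 + inner ℝ x e := by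
    rcases C.eq_empty_or_nonempty with rfl | hCn
    · exact ⟨1, one_pos, by simp⟩
    · obtain ⟨x₀, hx₀, hmin⟩ := hC.exists_isMinOn hCn
        (f := fun x : W => 1 + inner ℝ x e) (by fun_prop)
      refine ⟨_, ?_, fun x hx => hmin hx⟩
      have hx1 : ‖x₀‖ = 1 := by simpa using hCs hx₀
      have h1 : ‖x₀ + e‖ ^ 2 = 2 * (1 + inner ℝ x₀ e) := by
        rw [norm_add_sq_real, hx1, he]; ring
      have h2 : 0 < ‖x₀ + e‖ := norm_pos_iff.2 fun h => hne (by
        rwa [← eq_neg_of_add_eq_zero_left h])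
      nlinarith
  obtain ⟨n, hn⟩ := pow_unbounded_of_one_lt (8 / (c * ε ^ 2))
    (show 1 < (1 + t) ^ 2 by nlinarith)
  refine ⟨n, fun x hx => ?_⟩
  have hx1 : ‖x‖ = 1 := by simpa using hCs hx
  have h1 := boost_iterate_ratio he hx1 ht n
  have h2 : ‖(boost e t)^[n] x - e‖ ^ 2 = 2 * (1 - inner ℝ ((boost e t)^[n] x) e) := by
    rw [norm_sub_sq_real, norm_boost_iterate he hx1 ht, he]; ring
  rw [div_lt_iff₀ (by positivity)] at hn
  have h3 := hc x hx
  set q := ((1 + t) ^ 2) ^ n with hq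
  set d := ‖(boost e t)^[n] x - e‖ with hd
  have hq0 : 0 < q := by rw [hq]; have := ht.1; positivity
  have h4 : d ^ 2 * (c * q) ≤ 8 := by
    calc d ^ 2 * (c * q) ≤ d ^ 2 * ((1 + inner ℝ x e) * q) := by gcongr
      _ ≤ 8 := by rw [h2]; linarith
  have h5 : d ^ 2 < ε ^ 2 := by
    have h6 : d ^ 2 * (c * q) < ε ^ 2 * (c * q) := by linarith [mul_comm q (c * ε ^ 2)]
    exact lt_of_mul_lt_mul_right h6 (by positivity)
  exact lt_of_pow_lt_pow_left₀ 2 hε.le h5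

/-- The map is constant along rays outside the ball of radius `1 / 2`. -/
def Radial (g : W → V) : Prop := ∀ x, 1 / 2 ≤ ‖x‖ → g (‖x‖⁻¹ • x) = g x

/-- Ambient moves of an embedded sphere push a compact set missing `g (-e)` so that it meets
the sphere only near `g e`. -/
theorem exists_ambientMove_boost [FiniteDimensional ℝ W] [FiniteDimensional ℝ V] {g : W → V}
    (hgs : ContDiff ℝ ∞ g) (hg : SphereEmb g) (hr : Radial g) {e : W} (he : ‖e‖ = 1)
    {X : Set V} (hX : IsCompact X) (hXe : g (-e) ∉ X) {r : ℝ} (hr0 : 0 < r) :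
    ∃ ψ, AmbientMove (g '' sphere 0 1) ψ ∧
      ∀ z ∈ X, ψ z ∈ g '' sphere 0 1 → ψ z ∈ ball (g e) r := by
  obtain ⟨c, hc, hcg⟩ := hg.exists_leftInverse hgs
  set A := g '' sphere (0 : W) 1 with hA
  have hAc : IsCompact A := (isCompact_sphere _ _).image hgs.continuous
  obtain ⟨χ, hχc, hχ, -, hχ1⟩ : ∃ χ : V → ℝ, HasCompactSupport χ ∧ ContDiff ℝ ∞ χ ∧
      range χ ⊆ Icc 0 1 ∧ ∀ z ∈ A, χ z = 1 := by
    obtain ⟨R, hR⟩ := hAc.isBounded.subset_closedBall 0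
    let b : ContDiffBump (0 : V) := ⟨max R 1, max R 1 + 1, by positivity, by linarith⟩
    refine ⟨b, b.hasCompactSupport, b.contDiff, ?_, fun z hz => b.one_of_mem_closedBall
      (closedBall_subset_closedBall (le_max_left _ _) (hR hz))⟩
    rintro _ ⟨z, rfl⟩
    exact ⟨b.nonneg, b.le_one⟩
  let u : ℝ × V → V := fun p => χ p.2 • (g (c p.2 + p.1 • e) - g (c p.2))
  have hu : ContDiff ℝ ∞ u := by
    have hc2 : ContDiff ℝ ∞ fun p : ℝ × V => c p.2 := hc.comp contDiff_snd
    exact (hχ.comp contDiff_snd).smul ((hgs.comp (hc2.add (contDiff_fst.smul contDiff_const))).sub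
      (hgs.comp hc2))
  have hu_on : ∀ t ∈ Icc (0 : ℝ) (1 / 2), ∀ x : W, ‖x‖ = 1 →
      g x + u (t, g x) = g (boost e t x) := by
    intro t ht x hx
    have hxs : x ∈ sphere (0 : W) 1 := by simpa using hx
    simp only [u, hχ1 _ ⟨x, hxs, rfl⟩, hcg x hxs, one_smul, add_sub_cancel]
    exact (hr _ (half_le_norm_add_smul he hx ht)).symm
  obtain ⟨δ, hδ, hmove⟩ := exists_ambientMove_of_compact_support (A := A) hu (by simp [u]) hχc
    (fun t z hz => by simp [u, image_eq_zero_of_notMem_tsupport hz]) (ε := 1 / 2) (by norm_num)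
    (fun t ht hinj z => by
      constructor
      · rintro ⟨y, hy, hyz⟩
        obtain ⟨x, hx, rfl⟩ := exists_boost_eq he (by simpa using hy) ht
        rw [← hu_on t ht x hx] at hyz
        exact ⟨x, by simpa using hx, hinj hyz⟩
      · rintro ⟨x, hx, rfl⟩
        rw [hu_on t ht x (by simpa using hx)]
        exact ⟨_, by simpa using norm_boost he (by simpa using hx) ht, rfl⟩)
  set t := min δ (1 / 2) with htd
  have ht : t ∈ Icc (0 : ℝ) (1 / 2) := ⟨by positivity, min_le_right _ _⟩
  have ht0 : 0 < t := by positivity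
  have hiter : ∀ n : ℕ, ∀ x : W, ‖x‖ = 1 →
      (fun z => z + u (t, z))^[n] (g x) = g ((boost e t)^[n] x) := by
    intro n x hx
    induction n with
    | zero => rfl
    | succ n ih =>
      rw [Function.iterate_succ_apply', ih, Function.iterate_succ_apply']
      exact hu_on t ht _ (norm_boost_iterate he hx ht n)
  obtain ⟨ε, hε, hεr⟩ := Metric.continuousAt_iff.1 (hgs.continuous.continuousAt (x := e)) r hr0
  obtain ⟨n, hn⟩ := exists_boost_iterate_close he
    (((isCompact_sphere (0 : W) 1).inter_right (hX.isClosed.preimage hgs.continuous)))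
    inter_subset_left (fun h => hXe h.2) ht ht0 hε
  have hm := (hmove t ⟨ht.1, min_le_left _ _⟩).iterate n
  refine ⟨_, hm, fun z hz hzA => ?_⟩
  obtain ⟨x, hx, rfl⟩ := (hm.mem_iff z).1 hzA
  rw [hiter n x (by simpa using hx), mem_ball]
  exact hεr (by rw [dist_eq_norm]; exact hn x ⟨hx, hz⟩)

end Boost

section Moves

variable {V : Type*} [NormedAddCommGroup V] [NormedSpace ℝ V]

theorem exists_smooth_cutoff [FiniteDimensional ℝ V] {K Z : Set V} (hK : IsCompact K)
    (hZ : IsClosed Z) (hd : Disjoint K Z) :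
    ∃ χ : V → ℝ, ContDiff ℝ ∞ χ ∧ HasCompactSupport χ ∧ (∀ z, χ z ∈ Icc (0 : ℝ) 1) ∧
      (∀ z ∈ K, χ z = 1) ∧ ∀ z ∈ Z, χ z = 0 := by
  obtain ⟨R, hR⟩ := hK.isBounded.subset_ball 0
  obtain ⟨χ, h0, h1, h2⟩ := exists_contMDiffMap_zero_one_of_isClosed (n := ⊤) 𝓘(ℝ, V)
    (s := Z ∪ (ball 0 R)ᶜ) (t := K) (hZ.union isOpen_ball.isClosed_compl) hK.isClosed
    (by
      rw [disjoint_union_left]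
      exact ⟨hd.symm, (disjoint_compl_left_iff_subset).2 hR⟩)
  refine ⟨χ, χ.contMDiff.contDiff, ?_, h2, h1, fun z hz => h0 (Or.inl hz)⟩
  have := FiniteDimensional.proper ℝ V
  refine HasCompactSupport.of_support_subset_isCompact (isCompact_closedBall (0 : V) R) ?_
  intro z hz
  by_contra hzR
  exact hz (h0 (Or.inr fun h => hzR (ball_subset_closedBall h)))

theorem AmbientMove.of_lipschitz {A : Set V} {u : ℝ × V → V} (hu : ContDiff ℝ ∞ u)
    (h0 : ∀ z, u (0, z) = 0)
    (hL : ∀ t ∈ Icc (0 : ℝ) 1, LipschitzWith (1 / 2) fun z => u (t, z))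
    (hA : ∀ t ∈ Icc (0 : ℝ) 1, Function.Injective (fun z => z + u (t, z)) →
      ∀ z, z + u (t, z) ∈ A ↔ z ∈ A) :
    AmbientMove A fun z => z + u (1, z) := by
  refine ⟨fun p => p.2 + u p, contDiff_snd.add hu, fun t ht => ?_, fun z => by simp [h0],
    fun z => rfl⟩
  have hi := injective_add_of_lipschitz_half (hL t ht)
  refine ⟨hi, fun z => ?_, hA t ht hi⟩
  change Function.Injective (fderiv ℝ (fun z => z + u (t, z)) z)
  rw [fderiv_id_add (hu.slice t)]
  exact injective_id_add_of_norm_le_half (norm_fderiv_le_half (hL t ht) z)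

/-- Small translations cut off near `A` are ambient moves of `A`. -/
theorem exists_ambientMove_translate {A : Set V} {ρ : V → ℝ} (hρ : ContDiff ℝ ∞ ρ)
    (hc : HasCompactSupport ρ) (hA : ∀ z ∈ A, ρ z = 0) :
    ∃ δ > 0, ∀ v : V, ‖v‖ < δ → AmbientMove A fun z => z + ρ z • v := by
  obtain ⟨M, hM⟩ := (hρ.continuous_fderiv (by simp)).bounded_above_of_compact_support
    (hc.fderiv (𝕜 := ℝ))
  have hLip : LipschitzWith (Real.toNNReal M) ρ :=
    lipschitzWith_of_nnnorm_fderiv_le (𝕜 := ℝ) (hρ.differentiable (by simp)) fun x => by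
      rw [← NNReal.coe_le_coe, coe_nnnorm]
      exact (hM x).trans (Real.le_coe_toNNReal M)
  set L : ℝ := (Real.toNNReal M : ℝ) with hLdef
  have hL0 : 0 ≤ L := NNReal.coe_nonneg _
  refine ⟨1 / (2 * (L + 1)), by positivity, fun v hv => ?_⟩
  have hvL : L * ‖v‖ ≤ 1 / 2 := by
    rw [lt_div_iff₀ (by positivity)] at hv
    nlinarith [norm_nonneg v]
  have hu : ContDiff ℝ ∞ fun p : ℝ × V => (p.1 * ρ p.2) • v :=
    (contDiff_fst.mul (hρ.comp contDiff_snd)).smul contDiff_const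
  have := AmbientMove.of_lipschitz (A := A) hu (by simp) (fun t ht => ?_) (fun t ht hi z => ?_)
  · simpa using this
  · refine LipschitzWith.of_dist_le_mul fun x y => ?_
    have h2 := hLip.dist_le_mul x y
    rw [Real.dist_eq] at h2
    rw [dist_eq_norm, ← sub_smul, norm_smul, ← mul_sub, Real.norm_eq_abs, abs_mul,
      abs_of_nonneg ht.1]
    calc t * |ρ x - ρ y| * ‖v‖ ≤ 1 * (L * dist x y) * ‖v‖ := by
          gcongr
          exact ht.2
      _ = (L * ‖v‖) * dist x y := by ring
      _ ≤ 1 / 2 * dist x y := by gcongr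
      _ = _ := by norm_num
  · constructor
    · intro h
      have h1 : (fun z => z + (t * ρ z) • v) z = (fun z => z + (t * ρ z) • v)
          (z + (t * ρ z) • v) := by
        simp [hA _ h]
      rw [hi h1]
      exact h
    · intro h
      simpa [hA z h] using h

/-- Contraction towards the origin, away from the non-flat part of `A`. -/
theorem exists_ambientMove_contract [FiniteDimensional ℝ V] {A : Set V} (hAc : IsClosed A)
    (P : Submodule ℝ V) {r : ℝ} (hP : ∀ z ∈ ball (0 : V) r, z ∈ A ↔ z ∈ P)
    {X O : Set V} (hX : IsCompact X) (hO : IsOpen O) (hO0 : (0 : V) ∈ O)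
    (hOs : ∀ z ∈ O, ∀ s ∈ Icc (0 : ℝ) 1, s • z ∈ O)
    (hXO : ∀ x ∈ X, ∀ s ∈ Icc (0 : ℝ) 1, s • x ∈ A \ ball 0 (r / 2) → s • x ∈ O) :
    ∃ ψ, AmbientMove A ψ ∧ ∀ x ∈ X, ψ x ∈ O := by
  set C : Set V := (fun p : ℝ × V => p.1 • p.2) '' (Icc 0 1 ×ˢ X) with hC
  have hCc : IsCompact C := (isCompact_Icc.prod hX).image (by fun_prop)
  have hCs : ∀ z ∈ C, ∀ s ∈ Icc (0 : ℝ) 1, s • z ∈ C := by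
    rintro _ ⟨⟨t, x⟩, ⟨ht, hx⟩, rfl⟩ s hs
    exact ⟨⟨s * t, x⟩, ⟨⟨mul_nonneg hs.1 ht.1, mul_le_one₀ hs.2 ht.1 ht.2⟩, hx⟩, mul_smul _ _ _⟩
  have hXC : X ⊆ C := fun x hx => ⟨(1, x), ⟨by simp, hx⟩, one_smul _ _⟩
  obtain ⟨χ, hχ, hχc, hχ01, hχ1, hχ0⟩ := exists_smooth_cutoff (hCc.diff hO)
    (hAc.inter (isOpen_ball (x := (0 : V)) (ε := r / 2)).isClosed_compl)
    (disjoint_left.2 fun z hz hzA => by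
      obtain ⟨⟨⟨s, x⟩, ⟨hs, hx⟩, rfl⟩, hzO⟩ := hz
      exact hzO (hXO x hx s hs hzA))
  let u : ℝ × V → V := fun p => -((p.1 * χ p.2) • p.2)
  have hu : ContDiff ℝ ∞ u :=
    ((contDiff_fst.mul (hχ.comp contDiff_snd)).smul contDiff_snd).neg
  have hzu : ∀ t z, z + u (t, z) = (1 - t * χ z) • z := fun t z => by
    simp only [u]; rw [sub_smul, one_smul, sub_eq_add_neg]
  have hfac : ∀ t ∈ Icc (0 : ℝ) (1 / 2), ∀ z, 1 - t * χ z ∈ Icc (1 / 2 : ℝ) 1 := by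
    intro t ht z
    have h1 := hχ01 z
    constructor
    · nlinarith [ht.1, ht.2, h1.1, h1.2]
    · nlinarith [ht.1, ht.2, h1.1, h1.2]
  obtain ⟨δ, hδ, hmove⟩ := exists_ambientMove_of_compact_support (A := A) hu (by simp [u]) hχc
    (fun t z hz => by simp [u, image_eq_zero_of_notMem_tsupport hz]) (ε := 1 / 2) (by norm_num)
    (fun t ht hinj z => by
      have hf := hfac t ht z
      have hnorm : ‖z + u (t, z)‖ = (1 - t * χ z) * ‖z‖ := by
        rw [hzu, norm_smul, Real.norm_eq_abs, abs_of_nonneg (by linarith [hf.1])]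
      constructor
      · intro h
        by_cases hb : z + u (t, z) ∈ ball (0 : V) (r / 2)
        · rw [mem_ball_zero_iff, hnorm] at hb
          have hz : z ∈ ball (0 : V) r := by
            rw [mem_ball_zero_iff]
            nlinarith [norm_nonneg z, hf.1, hf.2]
          have hzb : z + u (t, z) ∈ ball (0 : V) r := by
            rw [mem_ball_zero_iff] at hz ⊢
            rw [hnorm]
            nlinarith [norm_nonneg z, hf.1, hf.2]
          rw [hP _ hzb, hzu, P.smul_mem_iff (by linarith [hf.1])] at h
          exact (hP z hz).2 h
        · have h1 : (fun z => z + u (t, z)) z = (fun z => z + u (t, z)) (z + u (t, z)) := by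
            have : χ (z + u (t, z)) = 0 := hχ0 _ ⟨h, hb⟩
            simp only [u] at this ⊢
            simp [this]
          rw [hinj h1]
          exact h
      · intro h
        by_cases hb : z ∈ ball (0 : V) (r / 2)
        · have hr : 0 < r / 2 := pos_of_mem_ball hb
          rw [mem_ball_zero_iff] at hb
          have hz : z ∈ ball (0 : V) r := by
            rw [mem_ball_zero_iff]; linarith
          have hzb : z + u (t, z) ∈ ball (0 : V) r := by
            rw [mem_ball_zero_iff, hnorm]
            nlinarith [norm_nonneg z, hf.1, hf.2]
          rw [hP _ hzb, hzu]
          exact P.smul_mem _ ((hP z hz).1 h)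
        · rw [hzu, hχ0 z ⟨h, hb⟩]
          simpa using h)
  set t := min δ (1 / 2) with htd
  have ht : t ∈ Icc (0 : ℝ) (1 / 2) := ⟨by positivity, min_le_right _ _⟩
  have ht0 : 0 < t := by positivity
  have hm := hmove t ⟨ht.1, min_le_left _ _⟩
  simp only [hzu] at hm
  obtain ⟨η, hη, hηO⟩ := Metric.isOpen_iff.1 hO 0 hO0
  obtain ⟨R, hR0, hR⟩ := hX.isBounded.exists_pos_norm_le
  obtain ⟨N, hN⟩ := exists_pow_lt_of_lt_one (show 0 < η / R by positivity)
    (show 1 - t < 1 by linarith)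
  refine ⟨_, hm.iterate N, fun x hx => ?_⟩
  have key : ∀ n : ℕ, (fun z => (1 - t * χ z) • z)^[n] x ∈ C ∧
      ((fun z => (1 - t * χ z) • z)^[n] x ∈ O ∨
        (fun z => (1 - t * χ z) • z)^[n] x = (1 - t) ^ n • x) := by
    intro n
    induction n with
    | zero => exact ⟨hXC hx, Or.inr (by simp)⟩
    | succ n ih =>
      rw [Function.iterate_succ_apply']
      set y := (fun z => (1 - t * χ z) • z)^[n] x with hy
      have hf := hfac t ht y
      have hf' : 1 - t * χ y ∈ Icc (0 : ℝ) 1 := ⟨by linarith [hf.1], hf.2⟩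
      refine ⟨hCs y ih.1 _ hf', ?_⟩
      by_cases hyO : y ∈ O
      · exact Or.inl (hOs y hyO _ hf')
      · right
        have h1 : y = (1 - t) ^ n • x := ih.2.resolve_left hyO
        change (1 - t * χ y) • y = _
        rw [hχ1 y ⟨ih.1, hyO⟩, h1, smul_smul, mul_one, pow_succ']
  rcases (key N).2 with h | h
  · exact h
  · rw [h]
    apply hηO
    have h1 : 0 ≤ 1 - t := by linarith [ht.2]
    rw [mem_ball_zero_iff, norm_smul, Real.norm_eq_abs, abs_of_nonneg (by positivity)]
    rw [lt_div_iff₀ hR0] at hN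
    exact (mul_le_mul_of_nonneg_left (hR x hx) (by positivity)).trans_lt hN

end Moves

section Engulfing

variable {V : Type*} [NormedAddCommGroup V] [NormedSpace ℝ V] [FiniteDimensional ℝ V]

/-- The cone, with vertex the origin, over the translate of `X` by `v`. -/
def coneTranslate (X : Set V) (v : V) : Set V :=
  (fun p : ℝ × V => p.1 • (p.2 + v)) '' (Icc 0 1 ×ˢ X)

theorem coverDim_Icc (a b : ℝ) : CoverDim 1 (Icc a b) := by
  have := coverDim_of_isBounded (isBounded_Icc a b)
  simpa using this

/-- General position: the cone over a generic translate of a compact set. -/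
theorem exists_translate_coneTranslate (hV : Module.finrank ℝ V = 6) {X Z : Set V} {d : ℝ}
    (hX : IsCompact X) (hXd : CoverDim d X) (hZ : IsCompact Z) (hZd : CoverDim 3 Z)
    (hZ0 : (0 : V) ∉ Z) {b : V} (hb : b ≠ 0) {η : ℝ} (hη : 0 < η) (hdη : d + η < 5)
    {δ : ℝ} (hδ : 0 < δ) :
    ∃ v : V, ‖v‖ < δ ∧ CoverDim (d - 2 + η) (Z ∩ coneTranslate X v) ∧
      b ∉ coneTranslate X v := by
  obtain ⟨R, hR0, hR⟩ := hX.isBounded.exists_pos_norm_le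
  obtain ⟨ρ, hρ0, hρ⟩ : ∃ ρ > 0, ∀ z ∈ insert b Z, ρ ≤ ‖z‖ := by
    obtain ⟨z₀, hz₀, hmin⟩ := (hZ.insert b).exists_isMinOn (insert_nonempty _ _)
      continuous_norm.continuousOn
    refine ⟨‖z₀‖, norm_pos_iff.2 ?_, fun z hz => hmin hz⟩
    rintro rfl
    rcases hz₀ with h | h
    · exact hb h.symm
    · exact hZ0 h
  set Λ := (R + δ) / ρ with hΛ
  have hcone : ∀ v : V, ‖v‖ < δ → ∀ z ∈ insert b Z, ∀ x ∈ X, ∀ s ∈ Icc (0 : ℝ) 1,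
      s • (x + v) = z → s⁻¹ ∈ Icc 0 Λ ∧ s⁻¹ • z - x = v := by
    intro v hv z hz x hx s hs hsz
    have h1 : ρ ≤ s * (R + δ) := by
      calc ρ ≤ ‖z‖ := hρ z hz
        _ = s * ‖x + v‖ := by rw [← hsz, norm_smul, Real.norm_eq_abs, abs_of_nonneg hs.1]
        _ ≤ s * (R + δ) := by
          gcongr
          · exact hs.1
          · exact (norm_add_le _ _).trans (add_le_add (hR x hx) hv.le)
    have hs0 : 0 < s := by
      rcases eq_or_lt_of_le hs.1 with h | h
      · rw [← h, zero_mul] at h1; linarith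
      · exact h
    refine ⟨⟨by positivity, ?_⟩, ?_⟩
    · rw [hΛ, inv_eq_one_div, div_le_div_iff₀ hs0 hρ0]
      linarith
    · rw [← hsz, smul_smul, inv_mul_cancel₀ hs0.ne', one_smul, add_sub_cancel_left]
  let _ : MeasurableSpace V := borel V
  have : BorelSpace V := ⟨rfl⟩
  let μ : MeasureTheory.Measure V := MeasureTheory.Measure.addHaar
  have hY1 : CoverDim (1 + (3 + d)) (Icc (0 : ℝ) Λ ×ˢ (Z ×ˢ X)) :=
    (coverDim_Icc 0 Λ).prod (hZd.prod hXd)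
  have hY2 : CoverDim (1 + d) (Icc (0 : ℝ) Λ ×ˢ X) := (coverDim_Icc 0 Λ).prod hXd
  have hm1 : ContDiff ℝ ∞ fun p : ℝ × V × V => p.1 • p.2.1 - p.2.2 := by fun_prop
  have hm2 : ContDiff ℝ ∞ fun p : ℝ × V => p.1 • b - p.2 := by fun_prop
  obtain ⟨L1, hL1⟩ := hm1.exists_lipschitzOnWith
    ((isBounded_Icc (0 : ℝ) Λ).prod (hZ.isBounded.prod hX.isBounded))
  obtain ⟨L2, hL2⟩ := hm2.exists_lipschitzOnWith ((isBounded_Icc (0 : ℝ) Λ).prod hX.isBounded)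
  have hdense := MeasureTheory.Measure.dense_of_ae
    ((hY1.ae_fiber μ hL1 hη).and (hY2.ae_fiber μ hL2 hη))
  obtain ⟨v, ⟨hv1, hv2⟩, hv⟩ := hdense.exists_dist_lt 0 hδ |>.imp fun v h => And.intro h.1 h.2
  rw [dist_zero_left] at hv
  refine ⟨v, hv, ?_, ?_⟩
  · rw [hV] at hv1
    have h1 := hv1.image (f := fun p : ℝ × V × V => p.2.1) (L := 1)
      (LipschitzWith.prod_fst.comp LipschitzWith.prod_snd |>.weaken (by simp)).lipschitzOnWith
    refine (h1.mono ?_).mono_exp (by push_cast; linarith)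
    rintro z ⟨hz, ⟨s, x⟩, ⟨hs, hx⟩, hsz⟩
    have h2 := hcone v hv z (Or.inr hz) x hx s hs hsz
    exact ⟨(s⁻¹, z, x), ⟨⟨h2.1, hz, hx⟩, h2.2⟩, rfl⟩
  · rintro ⟨⟨s, x⟩, ⟨hs, hx⟩, hsz⟩
    have h2 := hcone v hv b (Or.inl rfl) x hx s hs hsz
    rw [hV] at hv2
    have h3 := hv2.eq_empty (by push_cast; linarith)
    exact (h3 ▸ (⟨⟨h2.1, hx⟩, h2.2⟩ : (s⁻¹, x) ∈ (Icc (0 : ℝ) Λ ×ˢ X) ∩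
      (fun p : ℝ × V => p.1 • b - p.2) ⁻¹' {v}) : (s⁻¹, x) ∈ (∅ : Set (ℝ × V)))

variable {W : Type*} [NormedAddCommGroup W] [InnerProductSpace ℝ W] [FiniteDimensional ℝ W]

/-- A compact set of small dimension missing one point of an embedded sphere can be shrunk by
ambient moves of the sphere into any ball around the antipodal point. -/
theorem exists_ambientMove_engulf (hV : Module.finrank ℝ V = 6) {g : W → V}
    (hgs : ContDiff ℝ ∞ g) (hg : SphereEmb g) (hr : Radial g)
    (hW : CoverDim 3 (sphere (0 : W) 1)) {e : W} (he : ‖e‖ = 1) (hge : g e = 0)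
    (P : Submodule ℝ V) {r : ℝ} (hr0 : 0 < r)
    (hP : ∀ z ∈ ball (0 : V) r, z ∈ g '' sphere 0 1 ↔ z ∈ P) (n : ℕ) (hn : n ≤ 4) :
    ∀ (X : Set V) (d : ℝ), IsCompact X → g (-e) ∉ X → CoverDim d X → d < n → ∀ ε > 0,
      ∃ ψ, AmbientMove (g '' sphere 0 1) ψ ∧ ∀ x ∈ X, ψ x ∈ ball (0 : V) ε := by
  induction n with
  | zero =>
    intro X d _ _ hXd hd ε _
    refine ⟨_, AmbientMove.id _, ?_⟩
    rw [hXd.eq_empty (by simpa using hd)]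
    simp
  | succ n ih =>
    intro X d hX hbX hXd hdn ε hε
    set A := g '' sphere (0 : W) 1 with hA
    have hAc : IsCompact A := (isCompact_sphere _ _).image hgs.continuous
    have hAd : CoverDim 3 A := hW.image_contDiff isBounded_sphere hgs
    have hn' : ((n + 1 : ℕ) : ℝ) ≤ 4 := by exact_mod_cast hn
    have hb0 : g (-e) ≠ 0 := by
      rw [← hge]
      intro h
      have h1 := hg.1 (by simpa using he) (by simpa using he) h
      have h2 : e = 0 := by
        have : (2 : ℝ) • e = 0 := by rw [two_smul]; nth_rw 1 [← h1]; simp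
        simpa using this
      rw [h2] at he
      simp at he
    obtain ⟨ψ₁, hψ₁, hψ₁A⟩ := exists_ambientMove_boost hgs hg hr he hX hbX
      (show 0 < r / 4 by positivity)
    rw [hge] at hψ₁A
    have hX₁ : IsCompact (ψ₁ '' X) := hX.image hψ₁.contDiff.continuous
    have hX₁d : CoverDim d (ψ₁ '' X) := hXd.image_contDiff hX.isBounded hψ₁.contDiff
    have hX₂ : IsCompact (ψ₁ '' X \ ball 0 (r / 3)) := hX₁.diff isOpen_ball
    have hX₂d : CoverDim d (ψ₁ '' X \ ball 0 (r / 3)) := hX₁d.mono sdiff_subset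
    set X₂ := ψ₁ '' X \ ball 0 (r / 3) with hX₂def
    obtain ⟨ρ, hρ, hρc, hρ01, hρ1, hρ0⟩ := exists_smooth_cutoff hX₂ hAc.isClosed
      (disjoint_left.2 fun z hz hzA => by
        obtain ⟨⟨x, hx, rfl⟩, hzb⟩ := hz
        exact hzb (ball_subset_ball (by linarith) (hψ₁A x hx hzA)))
    obtain ⟨δ, hδ, hmove⟩ := exists_ambientMove_translate hρ hρc hρ0
    set Z := A \ ball 0 (r / 2) with hZdef
    have hZ : IsCompact Z := hAc.diff isOpen_ball
    have hZ0 : (0 : V) ∉ Z := fun h => h.2 (mem_ball_self (by positivity))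
    set η : ℝ := ((n + 1 : ℕ) - d) / 2 with hη
    obtain ⟨v, hv, hΓd, hbv⟩ := exists_translate_coneTranslate hV hX₂ hX₂d hZ
      (hAd.mono sdiff_subset) hZ0 hb0 (show 0 < η by rw [hη]; linarith)
      (by rw [hη]; linarith) (show 0 < min δ (r / 6) by positivity)
    set Γ := Z ∩ coneTranslate X₂ v with hΓdef
    have hconec : IsCompact (coneTranslate X₂ v) := (isCompact_Icc.prod hX₂).image (by fun_prop)
    have hΓ : IsCompact Γ := hZ.inter hconec
    set S := (fun p : ℝ × V => p.1 • p.2) '' (Icc 0 1 ×ˢ Γ) with hSdef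
    have hS : IsCompact S := (isCompact_Icc.prod hΓ).image (by fun_prop)
    have hSd : CoverDim (1 + (d - 2 + η)) S :=
      ((coverDim_Icc 0 1).prod hΓd).image_contDiff
        ((isBounded_Icc (0 : ℝ) 1).prod hΓ.isBounded) (f := fun p : ℝ × V => p.1 • p.2)
        (by fun_prop)
    have hbS : g (-e) ∉ S := by
      rintro ⟨⟨t, z⟩, ⟨ht, -, ⟨s, x⟩, ⟨hs, hx⟩, rfl⟩, h⟩
      refine hbv ⟨(t * s, x), ⟨⟨mul_nonneg ht.1 hs.1, mul_le_one₀ ht.2 hs.1 hs.2⟩, hx⟩, ?_⟩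
      rw [← h]
      exact mul_smul _ _ _
    obtain ⟨G, O, hG, hO, hO0, hOs, hΓO, hGO⟩ : ∃ (G : V → V) (O : Set V), AmbientMove A G ∧
        IsOpen O ∧ (0 : V) ∈ O ∧ (∀ z ∈ O, ∀ s ∈ Icc (0 : ℝ) 1, s • z ∈ O) ∧ Γ ⊆ O ∧
        ∀ z ∈ O, G z ∈ ball (0 : V) ε := by
      rcases Γ.eq_empty_or_nonempty with hΓe | ⟨γ, hγ⟩
      · refine ⟨_, ball 0 ε, AmbientMove.id A, isOpen_ball, mem_ball_self hε, fun z hz s hs => ?_,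
          by simp [hΓe], fun z hz => hz⟩
        rw [mem_ball_zero_iff] at hz ⊢
        rw [norm_smul, Real.norm_eq_abs, abs_of_nonneg hs.1]
        exact (mul_le_of_le_one_left (norm_nonneg z) hs.2).trans_lt hz
      · obtain ⟨G, hG, hGS⟩ := ih (by omega) S _ hS hbS hSd
          (by rw [hη]; push_cast at hdn ⊢; linarith) ε hε
        obtain ⟨κ, hκ, hκO⟩ := hS.exists_thickening_subset_open
          (isOpen_ball.preimage hG.contDiff.continuous) hGS
        refine ⟨G, thickening κ S, hG, isOpen_thickening, self_subset_thickening hκ _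
          ⟨(0, γ), ⟨by simp, hγ⟩, zero_smul _ _⟩, fun z hz s hs => ?_, fun z hz =>
          self_subset_thickening hκ _ ⟨(1, z), ⟨by simp, hz⟩, one_smul _ _⟩, hκO⟩
        rw [mem_thickening_iff] at hz ⊢
        obtain ⟨_, ⟨⟨t, w⟩, ⟨ht, hw⟩, rfl⟩, hzw⟩ := hz
        refine ⟨s • t • w, ⟨(s * t, w), ⟨⟨mul_nonneg hs.1 ht.1, mul_le_one₀ hs.2 ht.1 ht.2⟩,
          hw⟩, mul_smul _ _ _⟩, ?_⟩
        rw [dist_eq_norm, ← smul_sub, norm_smul, Real.norm_eq_abs, abs_of_nonneg hs.1]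
        refine (mul_le_of_le_one_left (norm_nonneg _) hs.2).trans_lt ?_
        rwa [dist_eq_norm] at hzw
    have hψ₂ := hmove v (hv.trans_le (min_le_left _ _))
    obtain ⟨ψ₃, hψ₃, hψ₃O⟩ := exists_ambientMove_contract hAc.isClosed P hP
      (hX₁.image hψ₂.contDiff.continuous) hO hO0 hOs (by
        rintro _ ⟨x, hx, rfl⟩ s hs hsZ
        by_cases hxb : x ∈ ball (0 : V) (r / 3)
        · exfalso
          apply hsZ.2
          have hρx := hρ01 x
          rw [mem_ball_zero_iff] at hxb ⊢
          rw [norm_smul, Real.norm_eq_abs, abs_of_nonneg hs.1]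
          have h1 : ‖x + ρ x • v‖ ≤ ‖x‖ + ‖v‖ := by
            refine (norm_add_le _ _).trans (add_le_add_right ?_ _)
            rw [norm_smul, Real.norm_eq_abs, abs_of_nonneg hρx.1]
            exact mul_le_of_le_one_left (norm_nonneg v) hρx.2
          have h2 := hv.trans_le (min_le_right δ (r / 6))
          exact (mul_le_of_le_one_left (norm_nonneg _) hs.2).trans_lt (by linarith)
        · have hx2 : x ∈ X₂ := ⟨hx, hxb⟩
          beta_reduce at hsZ ⊢
          rw [hρ1 x hx2, one_smul] at hsZ ⊢
          exact hΓO ⟨hsZ, (s, x), ⟨hs, hx2⟩, rfl⟩)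
    exact ⟨_, hG.comp (hψ₃.comp (hψ₂.comp hψ₁)), fun x hx =>
      hGO _ (hψ₃O _ ⟨_, ⟨x, hx, rfl⟩, rfl⟩)⟩

end Engulfing

theorem coverDim_sphere {W : Type*} [NormedAddCommGroup W] [InnerProductSpace ℝ W]
    {n : ℕ} (hW : Module.finrank ℝ W = n + 1) : CoverDim n (sphere (0 : W) 1) := by
  have hWf : FiniteDimensional ℝ W := FiniteDimensional.of_finrank_eq_succ hW
  have : Nontrivial W := Module.nontrivial_of_finrank_pos (R := ℝ) (by omega)
  obtain ⟨e, he⟩ := exists_norm_eq W zero_le_one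
  have half : ∀ v : W, ‖v‖ = 1 →
      CoverDim n {x : W | x ∈ sphere (0 : W) 1 ∧ inner ℝ v x ≤ 0} := by
    intro v hv
    have : Fact (Module.finrank ℝ W = n + 1) := ⟨hW⟩
    have hrank : Module.finrank ℝ (ℝ ∙ v)ᗮ = n :=
      Submodule.finrank_orthogonal_span_singleton (by rintro rfl; simp at hv)
    have h1 : CoverDim n (closedBall (0 : (ℝ ∙ v)ᗮ) 2) := by
      have := coverDim_of_isBounded (isBounded_closedBall (x := (0 : (ℝ ∙ v)ᗮ)) (r := 2))
      rwa [hrank] at this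
    have h2 := h1.image_contDiff isBounded_closedBall
      (((contDiff_stereoInvFunAux (v := v)).of_le le_top).comp
        ((ℝ ∙ v)ᗮ.subtypeL.contDiff) : ContDiff ℝ ∞ fun w : (ℝ ∙ v)ᗮ => stereoInvFunAux v w)
    refine h2.mono ?_
    rintro x ⟨hx, hxv⟩
    have hne : (⟨x, hx⟩ : sphere (0 : W) 1) ≠ ⟨v, by simpa using hv⟩ := by
      intro h
      have : x = v := congrArg Subtype.val h
      rw [this, real_inner_self_eq_norm_sq, hv] at hxv
      norm_num at hxv
    have hl := stereo_left_inv hv (x := ⟨x, hx⟩) (by simpa using fun h => hne (Subtype.ext h))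
    refine ⟨stereoToFun v x, ?_, congrArg Subtype.val hl⟩
    rw [mem_closedBall_zero_iff, stereoToFun, norm_smul]
    have h3 : ‖(ℝ ∙ v)ᗮ.orthogonalProjectionOnto x‖ ≤ 1 := by
      refine ((ℝ ∙ v)ᗮ.norm_orthogonalProjectionOnto_apply_le x).trans ?_
      rw [mem_sphere_zero_iff_norm.1 hx]
    have h4 : ‖(2 : ℝ) / ((1 : ℝ) - innerSL ℝ v x)‖ ≤ 2 := by
      rw [innerSL_apply_apply, Real.norm_eq_abs,
        abs_of_nonneg (div_nonneg (by norm_num) (by linarith)),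
        div_le_iff₀ (by linarith)]
      linarith
    calc _ ≤ (2 : ℝ) * 1 := mul_le_mul h4 h3 (norm_nonneg _) (by norm_num)
      _ = 2 := by norm_num
  refine ((half e he).union (half (-e) (by rwa [norm_neg]))).mono fun x hx => ?_
  rcases le_total (inner ℝ e x) 0 with h | h
  · exact Or.inl ⟨hx, h⟩
  · exact Or.inr ⟨hx, by rw [inner_neg_left]; linarith⟩

section

open scoped Matrix

section LinearPath

/-- A matrix joined to the identity by a smooth path of invertible matrices. -/
def JoinedToOne {n : Type*} [Fintype n] [DecidableEq n] (M : Matrix n n ℝ) : Prop :=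
  ∃ γ : ℝ → Matrix n n ℝ, (∀ i j, ContDiff ℝ ∞ fun s => γ s i j) ∧
    (∀ s ∈ Icc (0 : ℝ) 1, (γ s).det ≠ 0) ∧ γ 0 = M ∧ γ 1 = 1

variable {n : Type*} [Fintype n] [DecidableEq n]

theorem JoinedToOne.one : JoinedToOne (1 : Matrix n n ℝ) :=
  ⟨fun _ => 1, fun _ _ => contDiff_const, fun _ _ => by simp, rfl, rfl⟩

theorem JoinedToOne.mul {M N : Matrix n n ℝ} (hM : JoinedToOne M) (hN : JoinedToOne N) :
    JoinedToOne (M * N) := by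
  obtain ⟨γ, h1, h2, h3, h4⟩ := hM
  obtain ⟨γ', h1', h2', h3', h4'⟩ := hN
  refine ⟨fun s => γ s * γ' s, fun i j => ?_, fun s hs => ?_, by simp [h3, h3'], by
    simp [h4, h4']⟩
  · simp only [Matrix.mul_apply]
    exact ContDiff.sum fun k _ => (h1 i k).mul (h1' k j)
  · rw [Matrix.det_mul]
    exact mul_ne_zero (h2 s hs) (h2' s hs)

theorem JoinedToOne.transvection {i j : n} (hij : i ≠ j) (c : ℝ) :
    JoinedToOne (Matrix.transvection i j c) := by
  refine ⟨fun s => Matrix.transvection i j ((1 - s) * c), fun k l => ?_, fun s _ => ?_, by simp,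
    by simp⟩
  · simp only [Matrix.transvection, Matrix.add_apply, Matrix.single_apply]
    refine contDiff_const.add ?_
    split_ifs
    · exact (contDiff_const.sub contDiff_id).mul contDiff_const
    · exact contDiff_const
  · rw [Matrix.det_transvection_of_ne _ _ hij]
    exact one_ne_zero

theorem JoinedToOne.prod_transvections (L : List (Matrix.TransvectionStruct n ℝ)) :
    JoinedToOne (L.map Matrix.TransvectionStruct.toMatrix).prod := by
  induction L with
  | nil => exact JoinedToOne.one
  | cons T L ih =>
    rw [List.map_cons, List.prod_cons]
    exact (JoinedToOne.transvection T.hij T.c).mul ih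

theorem JoinedToOne.diagonal_of_pos {d : n → ℝ} (hd : ∀ i, 0 < d i) :
    JoinedToOne (Matrix.diagonal d) := by
  refine ⟨fun s => Matrix.diagonal fun i => (1 - s) * d i + s, fun i j => ?_, fun s hs => ?_,
    by simp, by simp⟩
  · simp only [Matrix.diagonal_apply]
    split_ifs
    · exact ((contDiff_const.sub contDiff_id).mul contDiff_const).add contDiff_id
    · exact contDiff_const
  · rw [Matrix.det_diagonal]
    refine Finset.prod_ne_zero_iff.2 fun i _ => ne_of_gt ?_
    rcases eq_or_lt_of_le hs.1 with h | h
    · rw [← h]; simpa using hd i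
    · have := mul_nonneg (sub_nonneg.2 hs.2) (hd i).le
      linarith

theorem contDiff_cos_path : ContDiff ℝ ∞ fun s : ℝ => Real.cos (Real.pi * (1 - s)) :=
  Real.contDiff_cos.comp (contDiff_const.mul (contDiff_const.sub contDiff_id))

theorem contDiff_sin_path : ContDiff ℝ ∞ fun s : ℝ => Real.sin (Real.pi * (1 - s)) :=
  Real.contDiff_sin.comp (contDiff_const.mul (contDiff_const.sub contDiff_id))

theorem joinedToOne_neg_neg_one : JoinedToOne (Matrix.diagonal (![-1, -1, 1] : Fin 3 → ℝ)) := by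
  refine ⟨fun s => !![Real.cos (Real.pi * (1 - s)), -Real.sin (Real.pi * (1 - s)), 0;
    Real.sin (Real.pi * (1 - s)), Real.cos (Real.pi * (1 - s)), 0; 0, 0, 1],
    fun i j => ?_, fun s _ => ?_, ?_, ?_⟩
  · fin_cases i <;> fin_cases j <;> simp <;>
      first
        | exact contDiff_cos_path
        | exact contDiff_sin_path
        | exact contDiff_sin_path.neg
        | exact contDiff_const
  · rw [Matrix.det_fin_three]
    simp
    nlinarith [Real.sin_sq_add_cos_sq (Real.pi * (1 - s))]
  · ext i j
    fin_cases i <;> fin_cases j <;> simp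
  · ext i j
    fin_cases i <;> fin_cases j <;> simp

theorem joinedToOne_neg_one_neg : JoinedToOne (Matrix.diagonal (![-1, 1, -1] : Fin 3 → ℝ)) := by
  refine ⟨fun s => !![Real.cos (Real.pi * (1 - s)), 0, -Real.sin (Real.pi * (1 - s)); 0, 1, 0;
    Real.sin (Real.pi * (1 - s)), 0, Real.cos (Real.pi * (1 - s))],
    fun i j => ?_, fun s _ => ?_, ?_, ?_⟩
  · fin_cases i <;> fin_cases j <;> simp <;>
      first
        | exact contDiff_cos_path
        | exact contDiff_sin_path
        | exact contDiff_sin_path.neg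
        | exact contDiff_const
  · rw [Matrix.det_fin_three]
    simp
    nlinarith [Real.sin_sq_add_cos_sq (Real.pi * (1 - s))]
  · ext i j
    fin_cases i <;> fin_cases j <;> simp
  · ext i j
    fin_cases i <;> fin_cases j <;> simp

theorem JoinedToOne.diagonal {d : Fin 3 → ℝ} (hd : 0 < d 0 * d 1 * d 2) :
    JoinedToOne (Matrix.diagonal d) := by
  have hne : ∀ i, d i ≠ 0 := by
    intro i h
    fin_cases i <;> simp_all
  let σ : Fin 3 → ℝ := fun i => SignType.sign (d i)
  have hsplit : Matrix.diagonal d = Matrix.diagonal (fun i => |d i|) * Matrix.diagonal σ := by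
    rw [Matrix.diagonal_mul_diagonal]
    congr 1
    ext i
    exact (abs_mul_sign (d i)).symm
  rw [hsplit]
  refine (JoinedToOne.diagonal_of_pos fun i => abs_pos.2 (hne i)).mul ?_
  have hσ : ∀ a b c : ℝ, σ 0 = a → σ 1 = b → σ 2 = c → σ = ![a, b, c] := by
    rintro a b c rfl rfl rfl
    ext i; fin_cases i <;> rfl
  have hneg : ∀ i, d i < 0 → σ i = -1 := fun i h => by simp [σ, sign_neg h]
  have hpos : ∀ i, 0 < d i → σ i = 1 := fun i h => by simp [σ, sign_pos h]
  rcases lt_or_gt_of_ne (hne 0) with h0 | h0 <;> rcases lt_or_gt_of_ne (hne 1) with h1 | h1 <;>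
    rcases lt_or_gt_of_ne (hne 2) with h2 | h2
  · exact absurd hd (mul_neg_of_pos_of_neg (mul_pos_of_neg_of_neg h0 h1) h2).not_gt
  · rw [hσ _ _ _ (hneg 0 h0) (hneg 1 h1) (hpos 2 h2)]
    exact joinedToOne_neg_neg_one
  · rw [hσ _ _ _ (hneg 0 h0) (hpos 1 h1) (hneg 2 h2)]
    exact joinedToOne_neg_one_neg
  · exact absurd hd (mul_neg_of_neg_of_pos (mul_neg_of_neg_of_pos h0 h1) h2).not_gt
  · rw [hσ _ _ _ (hpos 0 h0) (hneg 1 h1) (hneg 2 h2)]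
    have := joinedToOne_neg_neg_one.mul joinedToOne_neg_one_neg
    rw [Matrix.diagonal_mul_diagonal] at this
    have h : (fun i => (![-1, -1, 1] : Fin 3 → ℝ) i * (![-1, 1, -1] : Fin 3 → ℝ) i) =
        ![1, -1, -1] := by
      ext i
      fin_cases i <;> simp
    rwa [h] at this
  · exact absurd hd (mul_neg_of_neg_of_pos (mul_neg_of_pos_of_neg h0 h1) h2).not_gt
  · exact absurd hd (mul_neg_of_pos_of_neg (mul_pos h0 h1) h2).not_gt
  · rw [hσ _ _ _ (hpos 0 h0) (hpos 1 h1) (hpos 2 h2)]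
    have h : Matrix.diagonal (![1, 1, 1] : Fin 3 → ℝ) = 1 := by
      ext i j
      fin_cases i <;> fin_cases j <;> simp
    rw [h]
    exact JoinedToOne.one

theorem JoinedToOne.of_det_pos {M : Matrix (Fin 3) (Fin 3) ℝ} (hM : 0 < M.det) :
    JoinedToOne M := by
  obtain ⟨L, L', D, rfl⟩ := Matrix.Pivot.exists_list_transvec_mul_diagonal_mul_list_transvec M
  refine ((JoinedToOne.prod_transvections L).mul (JoinedToOne.diagonal ?_)).mul
    (JoinedToOne.prod_transvections L')
  rw [Matrix.det_mul, Matrix.det_mul, Matrix.TransvectionStruct.det_toMatrix_prod,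
    Matrix.TransvectionStruct.det_toMatrix_prod, Matrix.det_diagonal, one_mul, mul_one,
    Fin.prod_univ_three] at hM
  exact hM

end LinearPath

end

section

open scoped Matrix

/-- A linear automorphism of `F × F` with positive determinant fixing `F × 0` pointwise is joined
to the identity through such automorphisms. -/
theorem exists_linear_path {L : ((Fin 3 → ℝ) × (Fin 3 → ℝ)) →L[ℝ] (Fin 3 → ℝ) × (Fin 3 → ℝ)}
    (hL : ∀ u, L (u, 0) = (u, 0)) (hdet : 0 < L.det) :
    ∃ M : ℝ → ((Fin 3 → ℝ) × (Fin 3 → ℝ)) →L[ℝ] (Fin 3 → ℝ) × (Fin 3 → ℝ),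
      (ContDiff ℝ ∞ fun p : ℝ × ((Fin 3 → ℝ) × (Fin 3 → ℝ)) => M p.1 p.2) ∧
      (∀ s ∈ Icc (0 : ℝ) 1, Function.Injective (M s)) ∧ (∀ s u, M s (u, 0) = (u, 0)) ∧
      M 0 = L ∧ M 1 = ContinuousLinearMap.id ℝ _ := by
  set F := Fin 3 → ℝ
  let B : F →L[ℝ] F := (ContinuousLinearMap.fst ℝ F F).comp
    (L.comp (ContinuousLinearMap.inr ℝ F F))
  let D : F →L[ℝ] F := (ContinuousLinearMap.snd ℝ F F).comp
    (L.comp (ContinuousLinearMap.inr ℝ F F))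
  have hLBD : ∀ u v, L (u, v) = (u + B v, D v) := by
    intro u v
    have h1 : ((u, v) : F × F) = (u, 0) + (0, v) := by simp
    rw [h1, map_add, hL]
    ext1 <;> simp [B, D]
  let Sh : ℝ → F × F →ₗ[ℝ] F × F := fun c =>
    (LinearMap.fst ℝ F F + c • (B : F →ₗ[ℝ] F).comp (LinearMap.snd ℝ F F)).prod
      (LinearMap.snd ℝ F F)
  have hdetD : 0 < LinearMap.det (D : F →ₗ[ℝ] F) := by
    have h1 : (L : F × F →ₗ[ℝ] F × F) =
        (LinearMap.prodMap LinearMap.id (D : F →ₗ[ℝ] F)) * (Sh (1 / 2) * Sh (1 / 2)) := by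
      refine LinearMap.ext fun p => ?_
      obtain ⟨u, v⟩ := p
      change L (u, v) = ((u + (1 / 2 : ℝ) • B v) + (1 / 2 : ℝ) • B v, D v)
      rw [hLBD, add_assoc, ← add_smul]
      norm_num
    have h2 : L.det = LinearMap.det (L : F × F →ₗ[ℝ] F × F) := rfl
    rw [h2, h1, map_mul, map_mul, LinearMap.det_prodMap, LinearMap.det_id, one_mul] at hdet
    exact pos_of_mul_pos_left hdet (mul_self_nonneg _)
  have hM : 0 < (LinearMap.toMatrix' (D : F →ₗ[ℝ] F)).det := by
    rwa [LinearMap.det_toMatrix']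
  obtain ⟨γ, hγ, hγd, hγ0, hγ1⟩ := JoinedToOne.of_det_pos hM
  let M : ℝ → F × F →L[ℝ] F × F := fun s =>
    (ContinuousLinearMap.fst ℝ F F + (1 - s) • B.comp (ContinuousLinearMap.snd ℝ F F)).prod
      ((LinearMap.toContinuousLinearMap (Matrix.toLin' (γ s))).comp
        (ContinuousLinearMap.snd ℝ F F))
  have hMs : ∀ s u v, M s (u, v) = (u + (1 - s) • B v, γ s *ᵥ v) := fun s u v => rfl
  refine ⟨M, ?_, fun s hs => ?_, fun s u => ?_, ?_, ?_⟩
  · have h1 : ContDiff ℝ ∞ fun p : ℝ × (F × F) => p.2.1 + (1 - p.1) • B p.2.2 := by fun_prop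
    have h2 : ContDiff ℝ ∞ fun p : ℝ × (F × F) => γ p.1 *ᵥ p.2.2 := by
      refine contDiff_pi.2 fun i => ?_
      simp only [Matrix.mulVec, dotProduct]
      refine ContDiff.sum fun j _ => ((hγ i j).comp contDiff_fst).mul ?_
      fun_prop
    exact h1.prodMk h2
  · refine (injective_iff_map_eq_zero (M s)).2 ?_
    rintro ⟨u, v⟩ h
    rw [hMs, Prod.mk_eq_zero] at h
    have hv : v = 0 := Matrix.eq_zero_of_mulVec_eq_zero (hγd s hs) h.2
    rw [hv, map_zero, smul_zero, add_zero] at h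
    rw [hv, h.1]
    rfl
  · rw [hMs]; simp
  · refine ContinuousLinearMap.ext fun p => ?_
    obtain ⟨u, v⟩ := p
    rw [hMs, hLBD, hγ0, LinearMap.toMatrix'_mulVec]
    simp
  · refine ContinuousLinearMap.ext fun p => ?_
    obtain ⟨u, v⟩ := p
    rw [hMs, hγ1]
    simp
    rfl

end

section NearSubspace

variable {W V₁ V₂ : Type*} [NormedAddCommGroup W] [InnerProductSpace ℝ W]
  [NormedAddCommGroup V₁] [NormedSpace ℝ V₁] [NormedAddCommGroup V₂] [NormedSpace ℝ V₂]

/-- A homotopy through local embeddings fixing `V₁ × 0` moves embeddings close to the origin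
isotopically in the complement of `V₁ × 0`. -/
theorem exists_isotopic_comp_near {A : Set (V₁ × V₂)} {r : ℝ} (hr : 0 < r)
    (hA : ∀ z ∈ ball (0 : V₁ × V₂) r, z ∈ A ↔ z.2 = 0) {G : ℝ × (V₁ × V₂) → V₁ × V₂}
    (hG : ContDiff ℝ ∞ G) {ρ : ℝ} (hρ : 0 < ρ)
    (hi : ∀ s ∈ Icc (0 : ℝ) 1, InjOn (fun z => G (s, z)) (ball 0 ρ))
    (hd : ∀ s ∈ Icc (0 : ℝ) 1, ∀ z ∈ ball (0 : V₁ × V₂) ρ,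
      Function.Injective (fderiv ℝ (fun z => G (s, z)) z))
    (hf : ∀ s ∈ Icc (0 : ℝ) 1, ∀ u, ((u, 0) : V₁ × V₂) ∈ ball 0 ρ → G (s, u, 0) = (u, 0)) :
    ∃ ε > 0, ∀ h : W → V₁ × V₂, ContDiff ℝ ∞ h → SphereEmb h →
      (∀ x ∈ sphere (0 : W) 1, h x ∈ ball 0 ε ∧ h x ∉ A) →
      Isotopic A (fun x => G (0, h x)) (fun x => G (1, h x)) := by
  have hev : ∀ᶠ z in 𝓝 (0 : V₁ × V₂), ∀ s ∈ Icc (0 : ℝ) 1, G (s, z) ∈ ball 0 (min r ρ) := by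
    refine isCompact_Icc.eventually_forall_of_forall_eventually fun s hs => ?_
    have hc : Continuous fun p : (V₁ × V₂) × ℝ => G (p.2, p.1) :=
      hG.continuous.comp (continuous_snd.prodMk continuous_fst)
    refine hc.continuousAt.eventually (isOpen_ball.mem_nhds ?_)
    have : G (s, (0, 0)) = (0, 0) := hf s hs 0 (mem_ball_self hρ)
    change G (s, (0, 0)) ∈ _
    rw [this]
    exact mem_ball_self (lt_min hr hρ)
  obtain ⟨ε₀, hε₀, hball⟩ := Metric.eventually_nhds_iff_ball.1 hev
  refine ⟨min ε₀ (min r ρ), lt_min hε₀ (lt_min hr hρ), fun h hh hhe hhA => ?_⟩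
  refine ⟨fun p => G (p.1, h p.2), hG.comp (contDiff_fst.prodMk (hh.comp contDiff_snd)),
    fun s hs => ⟨?_, fun x hx hxA => ?_⟩, fun _ => rfl, fun _ => rfl⟩
  · refine hhe.comp hh (hG.slice s) ((hi s hs).mono ?_) fun x hx => hd s hs _ ?_
    · rintro _ ⟨x, hx, rfl⟩
      exact ball_subset_ball ((min_le_right _ _).trans (min_le_right _ _)) (hhA x hx).1
    · exact ball_subset_ball ((min_le_right _ _).trans (min_le_right _ _)) (hhA x hx).1
  · have h1 := hball (h x) (ball_subset_ball (min_le_left _ _) (hhA x hx).1) s hs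
    have h2 := (hA _ (ball_subset_ball (min_le_left _ _) h1)).1 hxA
    have h3 : G (s, h x) = ((G (s, h x)).1, 0) := Prod.ext rfl h2
    have h4 := ball_subset_ball (min_le_right r ρ) h1
    have h5 : G (s, h x) ∈ ball 0 ρ := h4
    rw [h3] at h4
    have h6 := hf s hs _ h4
    rw [← h3] at h6
    have h7 := hi s hs h5
      (ball_subset_ball ((min_le_right _ _).trans (min_le_right _ _)) (hhA x hx).1) h6
    refine (hhA x hx).2 ?_
    rw [← h7]
    exact hxA

end NearSubspace

/-- Coordinate three-space. -/
abbrev Triple : Type := Fin 3 → ℝ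

/-- A diffeomorphism fixing `A` pointwise and preserving orientation acts trivially, up to
isotopy, on embeddings close to a point at which `A` is flat. -/
theorem exists_isotopic_comp_of_det_pos {W : Type*} [NormedAddCommGroup W]
    [InnerProductSpace ℝ W] {A : Set (Triple × Triple)} {r : ℝ} (hr : 0 < r)
    (hA : ∀ z ∈ ball (0 : Triple × Triple) r, z ∈ A ↔ z.2 = 0)
    {Φ : Triple × Triple → Triple × Triple} (hΦ : ContDiff ℝ ∞ Φ)
    (hfix : ∀ z ∈ A, Φ z = z) (hdet : 0 < (fderiv ℝ Φ 0).det) :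
    ∃ ε > 0, ∀ h : W → Triple × Triple, ContDiff ℝ ∞ h → SphereEmb h →
      (∀ x ∈ sphere (0 : W) 1, h x ∈ ball 0 ε ∧ h x ∉ A) →
      Isotopic A h (fun x => Φ (h x)) := by
  set L := fderiv ℝ Φ 0 with hLdef
  have hΦP : ∀ u : Triple, ((u, 0) : Triple × Triple) ∈ ball 0 r → Φ (u, 0) = (u, 0) := fun u hu =>
    hfix _ ((hA _ hu).2 rfl)
  have hL : ∀ u : Triple, L (u, 0) = (u, 0) := by
    have h0 : HasFDerivAt Φ L ((0, 0) : Triple × Triple) := (hΦ.dif 0).hasFDerivAt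
    have h1 : HasFDerivAt (fun u : Triple => Φ (u, 0))
        (L.comp (ContinuousLinearMap.inl ℝ Triple Triple)) 0 :=
      HasFDerivAt.comp (f := fun u : Triple => (u, (0 : Triple))) (0 : Triple) h0
        (hasFDerivAt_prodMk_left (𝕜 := ℝ) (0 : Triple) (0 : Triple))
    have h2 : HasFDerivAt (fun u : Triple => Φ (u, 0))
        (ContinuousLinearMap.inl ℝ Triple Triple) 0 := by
      refine (hasFDerivAt_prodMk_left (𝕜 := ℝ) (0 : Triple) (0 : Triple)).congr_of_eventuallyEq ?_
      have hc : Continuous fun u : Triple => ((u, 0) : Triple × Triple) := by fun_prop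
      filter_upwards [hc.continuousAt.eventually (isOpen_ball.mem_nhds (mem_ball_self hr))]
        with u hu using hΦP u hu
    intro u
    exact congrArg (fun T : Triple →L[ℝ] Triple × Triple => T u) (h1.unique h2)
  have hLi : Function.Injective L :=
    (L.toContinuousLinearEquivOfDetNeZero hdet.ne').injective
  obtain ⟨c, hc, hLc⟩ : ∃ c > 0, ∀ z, c * ‖z‖ ≤ ‖L z‖ := by
    obtain ⟨k, hk, hLk⟩ := (L : Triple × Triple →ₗ[ℝ] Triple × Triple).exists_antilipschitzWith
      (LinearMap.ker_eq_bot.2 hLi)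
    refine ⟨(k : ℝ)⁻¹, by positivity, fun z => ?_⟩
    have := hLk.le_mul_dist z 0
    rw [map_zero, dist_zero_right, dist_zero_right] at this
    rw [inv_mul_le_iff₀ (by exact_mod_cast hk)]
    exact this
  let R : Triple × Triple → Triple × Triple := fun z => Φ z - L z
  have hR : ContDiff ℝ ∞ R := hΦ.sub L.contDiff
  have hR0 : fderiv ℝ R 0 = 0 := by
    have : HasFDerivAt R (L - L) 0 := (hΦ.dif 0).hasFDerivAt.sub L.hasFDerivAt
    rw [this.fderiv, sub_self]
  obtain ⟨ρ₀, hρ₀, hDR⟩ : ∃ ρ > 0, ∀ z ∈ ball (0 : Triple × Triple) ρ, ‖fderiv ℝ R z‖ < c / 2 := by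
    have hcont : Continuous fun z => ‖fderiv ℝ R z‖ := (hR.continuous_fderiv (by simp)).norm
    refine Metric.eventually_nhds_iff_ball.1 (hcont.continuousAt.eventually (gt_mem_nhds ?_))
    change ‖fderiv ℝ R 0‖ < _
    rw [hR0, norm_zero]
    exact half_pos hc
  let ρ := min ρ₀ r
  have hρ : 0 < ρ := lt_min hρ₀ hr
  have hRl : ∀ z ∈ ball (0 : Triple × Triple) ρ, ∀ w ∈ ball (0 : Triple × Triple) ρ,
      ‖R z - R w‖ ≤ c / 2 * ‖z - w‖ := fun z hz w hw =>
    (convex_ball 0 ρ).norm_image_sub_le_of_norm_fderiv_le (𝕜 := ℝ) (fun x _ => hR.dif x)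
      (fun x hx => (hDR x (ball_subset_ball (min_le_left _ _) hx)).le) hw hz
  let Ψ : ℝ × (Triple × Triple) → Triple × Triple := fun p => L p.2 + (1 - p.1) • R p.2
  have hΨ : ContDiff ℝ ∞ Ψ := by
    have h1 : ContDiff ℝ ∞ fun p : ℝ × (Triple × Triple) => R p.2 := hR.comp contDiff_snd
    have h2 : ContDiff ℝ ∞ fun p : ℝ × (Triple × Triple) => L p.2 := L.contDiff.comp contDiff_snd
    exact h2.add ((contDiff_const.sub contDiff_fst).smul h1)
  have hsmall : ∀ s ∈ Icc (0 : ℝ) 1, ∀ a b : Triple × Triple, ‖b‖ ≤ c / 2 * ‖a‖ →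
      L a + (1 - s) • b = 0 → a = 0 := by
    intro s hs a b hb h
    have h1 : ‖L a‖ ≤ ‖b‖ := by
      rw [eq_neg_of_add_eq_zero_left h, norm_neg, norm_smul, Real.norm_eq_abs,
        abs_of_nonneg (by linarith [hs.2])]
      exact mul_le_of_le_one_left (norm_nonneg _) (by linarith [hs.1])
    have h2 := hLc a
    by_contra ha
    have h3 := mul_pos hc (norm_pos_iff.2 ha)
    linarith
  obtain ⟨ε₁, hε₁, hiso₁⟩ := exists_isotopic_comp_near (W := W) hr hA hΨ hρ
    (fun s hs z hz w hw h => by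
      refine sub_eq_zero.1 (hsmall s hs (z - w) (R z - R w) (hRl z hz w hw) ?_)
      have h' : L z + (1 - s) • R z = L w + (1 - s) • R w := h
      rw [map_sub, smul_sub, ← sub_eq_zero.2 h']
      abel)
    (fun s hs z hz => by
      have h1 : HasFDerivAt (fun z => Ψ (s, z)) (L + (1 - s) • fderiv ℝ R z) z :=
        L.hasFDerivAt.add ((hR.dif z).hasFDerivAt.const_smul (1 - s))
      rw [h1.fderiv, injective_iff_map_eq_zero]
      intro a ha
      refine hsmall s hs a (fderiv ℝ R z a) ?_ ha
      exact (ContinuousLinearMap.le_opNorm _ _).trans (mul_le_mul_of_nonneg_right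
        (hDR z (ball_subset_ball (min_le_left _ _) hz)).le (norm_nonneg _)))
    (fun s hs u hu => by
      change L (u, 0) + (1 - s) • (Φ (u, 0) - L (u, 0)) = (u, 0)
      rw [hL, hΦP u (ball_subset_ball (min_le_right _ _) hu), sub_self, smul_zero, add_zero])
  obtain ⟨M, hM, hMi, hMf, hM0, hM1⟩ := exists_linear_path hL hdet
  obtain ⟨ε₂, hε₂, hiso₂⟩ := exists_isotopic_comp_near (W := W) hr hA hM hr
    (fun s hs => (hMi s hs).injOn)
    (fun s hs z _ => by
      have : fderiv ℝ (fun z => M s z) z = M s := (M s).fderiv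
      change Function.Injective (fderiv ℝ (fun z => M s z) z)
      rw [this]
      exact hMi s hs)
    (fun s _ u _ => hMf s u)
  refine ⟨min ε₁ ε₂, lt_min hε₁ hε₂, fun h hh hhe hhA => ?_⟩
  have h1 := hiso₁ h hh hhe fun x hx =>
    ⟨ball_subset_ball (min_le_left _ _) (hhA x hx).1, (hhA x hx).2⟩
  have h2 := hiso₂ h hh hhe fun x hx =>
    ⟨ball_subset_ball (min_le_right _ _) (hhA x hx).1, (hhA x hx).2⟩
  have e1 : (fun x => Ψ (0, h x)) = fun x => Φ (h x) := by
    funext x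
    simp [Ψ, R]
  have e2 : (fun x => Ψ (1, h x)) = fun x => L (h x) := by
    funext x
    simp [Ψ]
  rw [e1, e2] at h1
  simp only [hM0, hM1] at h2
  exact h2.symm.trans h1.symm

section Following

variable {V : Type*} [NormedAddCommGroup V] [NormedSpace ℝ V]

/-- An orientation preserving diffeomorphism of `V`, with its inverse. -/
def PosDiffeo (Φ Ψ : V → V) : Prop :=
  ContDiff ℝ ∞ Φ ∧ ContDiff ℝ ∞ Ψ ∧ (∀ z, Ψ (Φ z) = z) ∧ (∀ z, Φ (Ψ z) = z) ∧
    ∀ z, 0 < (fderiv ℝ Φ z).det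

theorem det_fderiv_comp {Φ Ψ : V → V} (hΦ : ContDiff ℝ ∞ Φ) (hΨ : ContDiff ℝ ∞ Ψ) (z : V) :
    (fderiv ℝ (fun z => Ψ (Φ z)) z).det = (fderiv ℝ Ψ (Φ z)).det * (fderiv ℝ Φ z).det := by
  have : fderiv ℝ (fun z => Ψ (Φ z)) z = (fderiv ℝ Ψ (Φ z)).comp (fderiv ℝ Φ z) :=
    fderiv_comp z (hΨ.dif _) (hΦ.dif z)
  rw [this]
  exact LinearMap.det_comp _ _

theorem PosDiffeo.symm {Φ Ψ : V → V} (h : PosDiffeo Φ Ψ) : PosDiffeo Ψ Φ := by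
  obtain ⟨h1, h2, h3, h4, h5⟩ := h
  refine ⟨h2, h1, h4, h3, fun z => ?_⟩
  have h6 := det_fderiv_comp h2 h1 z
  simp only [h4, fderiv_fun_id] at h6
  have h7 : (ContinuousLinearMap.id ℝ V).det = 1 := LinearMap.det_id
  rw [h7] at h6
  exact pos_of_mul_pos_right (h6 ▸ one_pos) (h5 _).le

theorem PosDiffeo.comp {Φ Ψ Φ' Ψ' : V → V} (h : PosDiffeo Φ Ψ) (h' : PosDiffeo Φ' Ψ') :
    PosDiffeo (fun z => Φ' (Φ z)) (fun z => Ψ (Ψ' z)) := by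
  obtain ⟨h1, h2, h3, h4, h5⟩ := h
  obtain ⟨h1', h2', h3', h4', h5'⟩ := h'
  refine ⟨h1'.comp h1, h2.comp h2', fun z => by simp only [h3', h3],
    fun z => by simp only [h4, h4'], fun z => ?_⟩
  rw [det_fderiv_comp h1 h1']
  exact mul_pos (h5' _) (h5 _)

variable [FiniteDimensional ℝ V]

theorem det_id_add_pos {L : V →L[ℝ] V} (hL : ‖L‖ ≤ 1 / 2) :
    0 < (ContinuousLinearMap.id ℝ V + L).det := by
  have hcont : Continuous fun s : ℝ => (ContinuousLinearMap.id ℝ V + s • L).det :=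
    ContinuousLinearMap.continuous_det.comp (by fun_prop)
  have hne : ∀ s ∈ Icc (0 : ℝ) 1, (ContinuousLinearMap.id ℝ V + s • L).det ≠ 0 := by
    intro s hs h
    have h1 : ‖s • L‖ ≤ 1 / 2 := by
      rw [norm_smul, Real.norm_eq_abs, abs_of_nonneg hs.1]
      exact (mul_le_of_le_one_left (norm_nonneg _) hs.2).trans hL
    have h2 := LinearMap.bot_lt_ker_of_det_eq_zero (f := ((ContinuousLinearMap.id ℝ V + s • L :
      V →L[ℝ] V) : V →ₗ[ℝ] V)) h
    exact h2.ne' (LinearMap.ker_eq_bot.2 (injective_id_add_of_norm_le_half h1))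
  by_contra! h
  have h0 : (ContinuousLinearMap.id ℝ V + (0 : ℝ) • L).det = 1 := by
    rw [zero_smul, add_zero]
    exact LinearMap.det_id
  obtain ⟨s, hs, h1⟩ := intermediate_value_Icc' (zero_le_one (α := ℝ)) hcont.continuousOn
    (show (0 : ℝ) ∈ Icc _ _ from ⟨by simpa using h, by rw [h0]; exact zero_le_one⟩)
  exact hne s hs h1

/-- A smooth bijection with injective differentials has a smooth inverse. -/
theorem ContDiff.of_inverse {f g : V → V} (hf : ContDiff ℝ ∞ f)
    (hd : ∀ z, Function.Injective (fderiv ℝ f z)) (hgf : ∀ z, g (f z) = z)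
    (hfg : ∀ z, f (g z) = z) : ContDiff ℝ ∞ g := by
  refine contDiff_iff_contDiffAt.2 fun y => ?_
  let f' : V ≃L[ℝ] V := (LinearEquiv.ofInjectiveEndo (fderiv ℝ f (g y) : V →ₗ[ℝ] V)
    (hd (g y))).toContinuousLinearEquiv
  have hf' : HasFDerivAt f (f' : V →L[ℝ] V) (g y) := by
    have : (f' : V →L[ℝ] V) = fderiv ℝ f (g y) := by
      ext z
      exact congrFun (LinearEquiv.coe_ofInjectiveEndo _ (hd (g y))) z
    rw [this]
    exact (hf.dif _).hasFDerivAt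
  have : CompleteSpace V := FiniteDimensional.complete ℝ V
  obtain ⟨e, he, hef, hes⟩ := hf.exists_openPartialHomeomorph hf'
  have hy : y ∈ e.target := by
    have := e.map_source he
    rwa [hef, hfg] at this
  have hnear : e.target ∈ 𝓝 y := e.open_target.mem_nhds hy
  refine (hes.contDiffAt hnear).congr_of_eventuallyEq ?_
  filter_upwards [hnear] with z hz
  have h1 : f (e.symm z) = z := by rw [← hef, e.right_inv hz]
  rw [← hgf (e.symm z), h1]

theorem exists_posDiffeo_of_lipschitz_half {w : V → V} (hw : ContDiff ℝ ∞ w)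
    (hL : LipschitzWith (1 / 2) w) : ∃ Ψ, PosDiffeo (fun z => z + w z) Ψ := by
  have hcomplete : CompleteSpace V := FiniteDimensional.complete ℝ V
  have hctr : ∀ y, ContractingWith (1 / 2) fun z => y - w z := by
    intro y
    refine ⟨by rw [← NNReal.coe_lt_coe]; norm_num, LipschitzWith.of_dist_le_mul fun a b => ?_⟩
    rw [dist_sub_left]
    exact hL.dist_le_mul a b
  let Ψ : V → V := fun y => ContractingWith.fixedPoint _ (hctr y)
  have hΨ : ∀ y, Ψ y + w (Ψ y) = y := by
    intro y
    have : y - w (Ψ y) = Ψ y := ContractingWith.fixedPoint_isFixedPt (hctr y)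
    exact (sub_eq_iff_eq_add.1 this).symm
  have hsm : ContDiff ℝ ∞ fun z => z + w z := contDiff_id.add hw
  have hinv : ∀ z, Ψ (z + w z) = z := fun z => injective_add_of_lipschitz_half hL (hΨ _)
  refine ⟨Ψ, hsm, hsm.of_inverse (fun z => ?_) hinv hΨ, hinv, hΨ, fun z => ?_⟩
  · rw [fderiv_id_add hw]
    exact injective_id_add_of_norm_le_half (norm_fderiv_le_half hL z)
  · rw [fderiv_id_add hw]
    exact det_id_add_pos (norm_fderiv_le_half hL z)

variable {W : Type*} [NormedAddCommGroup W] [InnerProductSpace ℝ W] [FiniteDimensional ℝ W]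

/-- Isotopy extension: an isotopy of two-component links is covered by an orientation preserving
diffeomorphism. -/
theorem exists_posDiffeo_following {H K : ℝ × W → V} (hH : ContDiff ℝ ∞ H)
    (hK : ContDiff ℝ ∞ K) (hHe : ∀ t ∈ Icc (0 : ℝ) 1, SphereEmb fun x => H (t, x))
    (hKe : ∀ t ∈ Icc (0 : ℝ) 1, SphereEmb fun x => K (t, x))
    (hHK : ∀ t ∈ Icc (0 : ℝ) 1, ∀ x ∈ sphere (0 : W) 1, ∀ y ∈ sphere (0 : W) 1,
      H (t, x) ≠ K (t, y)) :
    ∃ Φ Ψ : V → V, PosDiffeo Φ Ψ ∧ (∀ x ∈ sphere (0 : W) 1, Φ (H (0, x)) = H (1, x)) ∧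
      ∀ x ∈ sphere (0 : W) 1, Φ (K (0, x)) = K (1, x) := by
  let P : ℝ → ℝ → Prop := fun s t => ∃ Φ Ψ : V → V, PosDiffeo Φ Ψ ∧
    (∀ x ∈ sphere (0 : W) 1, Φ (H (s, x)) = H (t, x)) ∧
      ∀ x ∈ sphere (0 : W) 1, Φ (K (s, x)) = K (t, x)
  refine isPreconnected_Icc.induction₂ (s := Icc (0 : ℝ) 1) P (fun t₀ ht₀ => ?_) ?_ ?_
    (left_mem_Icc.2 zero_le_one) (right_mem_Icc.2 zero_le_one)
  · have hS : IsCompact (sphere (0 : W) 1) := isCompact_sphere 0 1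
    have hHc : IsCompact ((fun x => H (t₀, x)) '' sphere (0 : W) 1) :=
      hS.image (hH.slice t₀).continuous
    have hKc : IsCompact ((fun x => K (t₀, x)) '' sphere (0 : W) 1) :=
      hS.image (hK.slice t₀).continuous
    have hdis : Disjoint ((fun x => H (t₀, x)) '' sphere (0 : W) 1)
        ((fun x => K (t₀, x)) '' sphere (0 : W) 1) := by
      refine Set.disjoint_left.2 ?_
      rintro _ ⟨x, hx, rfl⟩ ⟨y, hy, h⟩
      exact hHK t₀ ht₀ x hx y hy h.symm
    obtain ⟨c₁, hc₁, hc₁H⟩ := (hHe t₀ ht₀).exists_leftInverse (hH.slice t₀)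
    obtain ⟨c₂, hc₂, hc₂K⟩ := (hKe t₀ ht₀).exists_leftInverse (hK.slice t₀)
    obtain ⟨α, hα, hαc, -, hα1, hα0⟩ := exists_smooth_cutoff hHc hKc.isClosed hdis
    obtain ⟨β, hβ, hβc, -, hβ1, hβ0⟩ := exists_smooth_cutoff hKc hHc.isClosed hdis.symm
    let u : ℝ × V → V := fun p =>
      α p.2 • (H (t₀ + p.1, c₁ p.2) - H (t₀, c₁ p.2)) +
        β p.2 • (K (t₀ + p.1, c₂ p.2) - K (t₀, c₂ p.2))
    have hterm : ∀ {γ : V → ℝ} {c : V → W} {G : ℝ × W → V}, ContDiff ℝ ∞ γ → ContDiff ℝ ∞ c →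
        ContDiff ℝ ∞ G → ContDiff ℝ ∞ fun p : ℝ × V =>
          γ p.2 • (G (t₀ + p.1, c p.2) - G (t₀, c p.2)) := by
      intro γ c G hγ hc hG
      refine (hγ.comp contDiff_snd).smul (ContDiff.sub ?_ ?_)
      · exact hG.comp ((contDiff_const.add contDiff_fst).prodMk (hc.comp contDiff_snd))
      · exact hG.comp (contDiff_const.prodMk (hc.comp contDiff_snd))
    have hu : ContDiff ℝ ∞ u := (hterm hα hc₁ hH).add (hterm hβ hc₂ hK)
    obtain ⟨δ, hδ, hL⟩ := exists_lipschitz_half_of_compact_support hu (fun z => by simp [u])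
      (hαc.isCompact.union hβc.isCompact) (fun t z hz => by
        rw [mem_union, not_or] at hz
        simp [u, image_eq_zero_of_notMem_tsupport hz.1, image_eq_zero_of_notMem_tsupport hz.2])
    refine Filter.Eventually.filter_mono nhdsWithin_le_nhds
      (Metric.eventually_nhds_iff.2 ⟨δ, hδ, fun t ht => ?_⟩)
    obtain ⟨Ψ, hΨ⟩ := exists_posDiffeo_of_lipschitz_half (hu.slice (t - t₀))
      (hL (t - t₀) (by rw [← Real.dist_eq]; exact ht.le))
    refine ⟨_, Ψ, hΨ, fun x hx => ?_, fun x hx => ?_⟩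
    · simp only [u]
      rw [hα1 _ ⟨x, hx, rfl⟩, hβ0 _ ⟨x, hx, rfl⟩, hc₁H x hx]
      simp
    · simp only [u]
      rw [hα0 _ ⟨x, hx, rfl⟩, hβ1 _ ⟨x, hx, rfl⟩, hc₂K x hx]
      simp
  · rintro s t v - - - ⟨Φ, Ψ, h, h1, h2⟩ ⟨Φ', Ψ', h', h1', h2'⟩
    exact ⟨_, _, h.comp h', fun x hx => by rw [h1 x hx, h1' x hx],
      fun x hx => by rw [h2 x hx, h2' x hx]⟩
  · rintro s t - - ⟨Φ, Ψ, h, h1, h2⟩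
    exact ⟨Ψ, Φ, h.symm, fun x hx => by rw [← h1 x hx, h.2.2.1],
      fun x hx => by rw [← h2 x hx, h.2.2.1]⟩

end Following

theorem ContDiffOn.exists_contDiff_eventuallyEq {X Y : Type*} [NormedAddCommGroup X]
    [NormedSpace ℝ X] [FiniteDimensional ℝ X] [NormedAddCommGroup Y] [NormedSpace ℝ Y]
    {φ : X → Y} {U : Set X} {a : X} (hφ : ContDiffOn ℝ ∞ φ U) (hU : U ∈ 𝓝 a) :
    ∃ φ' : X → Y, ContDiff ℝ ∞ φ' ∧ ∀ᶠ x in 𝓝 a, φ' x = φ x := by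
  obtain ⟨ρ, hρ, hρU⟩ := Metric.nhds_basis_closedBall.mem_iff.1 (interior_mem_nhds.2 hU)
  obtain ⟨χ, hχ, -, -, hχ1, hχ0⟩ := exists_smooth_cutoff (isCompact_closedBall a (ρ / 2))
    (Metric.isOpen_ball (x := a) (ε := ρ)).isClosed_compl (by
      rw [disjoint_compl_right_iff_subset]
      exact closedBall_subset_ball (half_lt_self hρ))
  refine ⟨fun x => χ x • φ x, contDiff_iff_contDiffAt.2 fun x => ?_, ?_⟩
  · by_cases hx : x ∈ interior U
    · exact hχ.contDiffAt.smul (hφ.contDiffAt (mem_interior_iff_mem_nhds.1 hx))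
    · have : (closedBall a ρ)ᶜ ∈ 𝓝 x :=
        isClosed_closedBall.isOpen_compl.mem_nhds fun h => hx (hρU h)
      refine contDiffAt_const (c := 0) |>.congr_of_eventuallyEq ?_
      filter_upwards [this] with y hy
      rw [hχ0 y fun h => hy (ball_subset_closedBall h), zero_smul]
  · filter_upwards [closedBall_mem_nhds a (half_pos hρ)] with x hx
    rw [hχ1 x hx, one_smul]

section Flatten

variable {W V : Type*} [NormedAddCommGroup W] [InnerProductSpace ℝ W] [FiniteDimensional ℝ W]
  [NormedAddCommGroup V] [NormedSpace ℝ V] [FiniteDimensional ℝ V]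

theorem exists_equiv_injective_fst (hV : Module.finrank ℝ V = 6) (hW : Module.finrank ℝ W = 4)
    {e : W} (he : ‖e‖ = 1) {D : W →L[ℝ] V} (hD : ∀ u, inner ℝ e u = 0 → D u = 0 → u = 0) :
    ∃ A : V ≃L[ℝ] Triple × Triple, ∀ u, inner ℝ e u = 0 → (A (D u)).1 = 0 → u = 0 := by
  let N : Submodule ℝ W := (ℝ ∙ e)ᗮ
  have hN : ∀ u, u ∈ N ↔ inner ℝ e u = 0 := fun u =>
    Submodule.mem_orthogonal_singleton_iff_inner_right
  have hNd : Module.finrank ℝ N = 3 := by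
    have : Fact (Module.finrank ℝ W = 3 + 1) := ⟨hW⟩
    exact Submodule.finrank_orthogonal_span_singleton (norm_ne_zero_iff.1 (by rw [he]; simp))
  let D' : N →ₗ[ℝ] V := (D : W →ₗ[ℝ] V).comp N.subtype
  have hD' : Function.Injective D' := by
    rw [injective_iff_map_eq_zero]
    intro u hu
    exact Subtype.ext (hD u ((hN u).1 u.2) hu)
  let T := LinearMap.range D'
  have hT : Module.finrank ℝ T = 3 := by rw [LinearMap.finrank_range_of_inj hD', hNd]
  obtain ⟨Q, hQ⟩ := T.exists_isCompl
  have hQd : Module.finrank ℝ Q = 3 := by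
    have := Submodule.finrank_add_eq_of_isCompl hQ
    omega
  let eT : T ≃ₗ[ℝ] Triple := LinearEquiv.ofFinrankEq _ _ (by rw [hT]; simp)
  let eQ : Q ≃ₗ[ℝ] Triple := LinearEquiv.ofFinrankEq _ _ (by rw [hQd]; simp)
  refine ⟨((Submodule.prodEquivOfIsCompl T Q hQ).symm.trans
    (eT.prodCongr eQ)).toContinuousLinearEquiv, fun u hu h => hD u hu ?_⟩
  let v : T := ⟨D u, ⟨u, (hN u).2 hu⟩, rfl⟩
  have h1 : (Submodule.prodEquivOfIsCompl T Q hQ).symm (D u) = (v, 0) :=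
    Submodule.prodEquivOfIsCompl_symm_apply_left T Q hQ v
  have h2 : eT v = 0 := by
    have h3 : (eT.prodCongr eQ ((Submodule.prodEquivOfIsCompl T Q hQ).symm (D u))).1 = 0 := h
    rw [h1] at h3
    exact h3
  exact congrArg Subtype.val ((LinearEquiv.map_eq_zero_iff eT).1 h2)

/-- A global diffeomorphism flattening an embedded sphere near a given point. -/
theorem exists_flattening (hV : Module.finrank ℝ V = 6) (hW : Module.finrank ℝ W = 4)
    {g : W → V} (hgs : ContDiff ℝ ∞ g) (hg : SphereEmb g) {e : W} (he : ‖e‖ = 1) :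
    ∃ (Θ : V → Triple × Triple) (Ξ : Triple × Triple → V), ContDiff ℝ ∞ Θ ∧ ContDiff ℝ ∞ Ξ ∧
      (∀ z, Ξ (Θ z) = z) ∧ (∀ z, Θ (Ξ z) = z) ∧ Θ (g e) = 0 ∧
      ∃ r > 0, ∀ z ∈ ball (0 : Triple × Triple) r,
        z ∈ (fun x => Θ (g x)) '' sphere 0 1 ↔ z.2 = 0 := by
  obtain ⟨A, hA⟩ := exists_equiv_injective_fst hV hW he (hg.2 e (by simpa using he))
  let g₁ : W → Triple × Triple := fun x => A (g x - g e)
  have hg₁ : ContDiff ℝ ∞ g₁ := A.contDiff.comp (hgs.sub contDiff_const)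
  have hg₁e : g₁ e = 0 := by simp [g₁]
  let q : W → Triple × ℝ := fun x => ((g₁ x).1, ‖x‖ ^ 2)
  have hq : ContDiff ℝ ∞ q := hg₁.fst.prodMk (contDiff_norm_sq ℝ)
  have hqe : q e = (0, 1) := by simp [q, hg₁e, he]
  let q' : W →L[ℝ] Triple × ℝ := ((ContinuousLinearMap.fst ℝ Triple Triple).comp
    ((A : V →L[ℝ] Triple × Triple).comp (fderiv ℝ g e))).prod (2 • innerSL ℝ e)
  have hq' : HasFDerivAt q q' e := by
    have h1 : HasFDerivAt (fun x => g x - g e) (fderiv ℝ g e) e :=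
      (hgs.dif e).hasFDerivAt.sub_const _
    have h2 : HasFDerivAt g₁ ((A : V →L[ℝ] Triple × Triple).comp (fderiv ℝ g e)) e :=
      A.hasFDerivAt.comp e h1
    exact h2.fst.prodMk (hasStrictFDerivAt_norm_sq e).hasFDerivAt
  have hq'i : Function.Injective q' := by
    rw [injective_iff_map_eq_zero]
    intro u hu
    have h1 : (A (fderiv ℝ g e u)).1 = 0 := congrArg Prod.fst hu
    have h2 : (2 • innerSL ℝ e) u = 0 := congrArg Prod.snd hu
    refine hA u ?_ h1
    simpa using h2
  let qe : W ≃L[ℝ] Triple × ℝ := (LinearEquiv.ofInjectiveOfFinrankEq (q' : W →ₗ[ℝ] Triple × ℝ)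
    hq'i (by rw [hW]; simp)).toContinuousLinearEquiv
  have hqe' : (qe : W →L[ℝ] Triple × ℝ) = q' := by
    ext1 u
    rfl
  have hcomplete : CompleteSpace W := FiniteDimensional.complete ℝ W
  obtain ⟨E₀, heE, hE, hEs⟩ := hq.exists_openPartialHomeomorph (f' := qe) (by rw [hqe']; exact hq')
  have hinc : ContDiff ℝ ∞ fun a : Triple => (a, (1 : ℝ)) := contDiff_id.prodMk contDiff_const
  have hU : (fun a : Triple => (a, (1 : ℝ))) ⁻¹' E₀.target ∈ 𝓝 (0 : Triple) := by
    refine hinc.continuous.continuousAt.preimage_mem_nhds (E₀.open_target.mem_nhds ?_)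
    have := E₀.map_source heE
    rwa [hE, hqe] at this
  obtain ⟨φ, hφ, hφe⟩ := ContDiffOn.exists_contDiff_eventuallyEq
    (φ := fun a => (g₁ (E₀.symm (a, 1))).2) (a := (0 : Triple))
    (hg₁.snd.comp_contDiffOn (hEs.comp hinc.contDiffOn (mapsTo_preimage _ _))) hU
  have hsymm : E₀.symm (0, 1) = e := by rw [← hqe, ← hE, E₀.left_inv heE]
  let Θ : V → Triple × Triple := fun z => ((A (z - g e)).1, (A (z - g e)).2 - φ (A (z - g e)).1)
  let Ξ : Triple × Triple → V := fun y => A.symm (y.1, y.2 + φ y.1) + g e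
  have hAs : ContDiff ℝ ∞ fun z => A (z - g e) := A.contDiff.comp (contDiff_id.sub contDiff_const)
  have hΘ : ContDiff ℝ ∞ Θ := hAs.fst.prodMk (hAs.snd.sub (hφ.comp hAs.fst))
  have hΞ : ContDiff ℝ ∞ Ξ := (A.symm.contDiff.comp
    (contDiff_fst.prodMk (contDiff_snd.add (hφ.comp contDiff_fst)))).add contDiff_const
  have hΞΘ : ∀ z, Ξ (Θ z) = z := fun z => by
    simp only [Ξ, Θ, sub_add_cancel, Prod.mk.eta, ContinuousLinearEquiv.symm_apply_apply]
  have hΘΞ : ∀ z, Θ (Ξ z) = z := fun z => by simp [Ξ, Θ]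
  have hΘe : Θ (g e) = 0 := by
    have : φ 0 = 0 := by
      rw [hφe.self_of_nhds, hsymm, hg₁e]
      rfl
    simp [Θ, this]
  refine ⟨Θ, Ξ, hΘ, hΞ, hΞΘ, hΘΞ, hΘe, ?_⟩
  obtain ⟨r₁, hr₁, hball⟩ := Metric.eventually_nhds_iff_ball.1
    (hφe.and (Filter.eventually_of_mem hU fun a ha => ha))
  have hΘg : ContDiff ℝ ∞ fun x => Θ (g x) := hΘ.comp hgs
  obtain ⟨r₂, hr₂, hfar⟩ : ∃ r > 0, ∀ x ∈ sphere (0 : W) 1, ‖Θ (g x)‖ < r → x ∈ E₀.source := by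
    have hc : IsCompact (sphere (0 : W) 1 \ E₀.source) :=
      (isCompact_sphere _ _).diff E₀.open_source
    have hc' : IsClosed ((fun x => Θ (g x)) '' (sphere (0 : W) 1 \ E₀.source)) :=
      (hc.image hΘg.continuous).isClosed
    have h0 : (0 : Triple × Triple) ∉ (fun x => Θ (g x)) '' (sphere (0 : W) 1 \ E₀.source) := by
      rintro ⟨x, ⟨hx, hxE⟩, h⟩
      have h1 : g x = g e := by rw [← hΞΘ (g x), ← hΞΘ (g e), hΘe]; exact congrArg Ξ h
      exact hxE (hg.1 hx (by simpa using he) h1 ▸ heE)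
    obtain ⟨r, hr, hrb⟩ := Metric.nhds_basis_ball.mem_iff.1 (hc'.isOpen_compl.mem_nhds h0)
    refine ⟨r, hr, fun x hx hxr => by_contra fun hxE => ?_⟩
    exact hrb (show Θ (g x) ∈ ball 0 r by simpa using hxr) ⟨x, ⟨hx, hxE⟩, rfl⟩
  refine ⟨min r₁ r₂, lt_min hr₁ hr₂, fun z hz => ?_⟩
  have hz1 : z.1 ∈ ball (0 : Triple) r₁ := by
    rw [mem_ball_zero_iff] at hz ⊢
    exact (norm_fst_le z).trans_lt (hz.trans_le (min_le_left _ _))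
  obtain ⟨hφz, hzt⟩ := hball z.1 hz1
  constructor
  · rintro ⟨x, hx, rfl⟩
    have hxE := hfar x hx ((mem_ball_zero_iff.1 hz).trans_le (min_le_right _ _))
    have h1 : q x = ((Θ (g x)).1, 1) := by
      have : ‖x‖ = 1 := by simpa using hx
      simp [q, this, Θ, g₁]
    have h2 : E₀.symm ((Θ (g x)).1, 1) = x := by rw [← h1, ← hE, E₀.left_inv hxE]
    change (g₁ x).2 - φ (Θ (g x)).1 = 0
    rw [hφz]
    simp only [h2, sub_self]
  · intro hz2
    let x := E₀.symm (z.1, 1)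
    have h1 : q x = (z.1, 1) := by rw [← hE]; exact E₀.right_inv hzt
    have h2 : ‖x‖ ^ 2 = 1 := congrArg Prod.snd h1
    have h3 : (q x).1 = z.1 := by rw [h1]
    change (g₁ x).1 = z.1 at h3
    have h4 : ‖x‖ = 1 := (pow_eq_one_iff_of_nonneg (norm_nonneg x) two_ne_zero).1 h2
    refine ⟨x, by simpa using h4, ?_⟩
    change ((g₁ x).1, (g₁ x).2 - φ (g₁ x).1) = z
    rw [h3, hφz]
    exact Prod.ext rfl (by simp [x, hz2])

end Flatten

theorem injective_fderiv_of_leftInverse {X Y : Type*} [NormedAddCommGroup X] [NormedSpace ℝ X]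
    [NormedAddCommGroup Y] [NormedSpace ℝ Y] {f : X → Y} {c : Y → X} (hf : ContDiff ℝ ∞ f)
    (hc : ContDiff ℝ ∞ c) (h : ∀ z, c (f z) = z) (z : X) : Function.Injective (fderiv ℝ f z) := by
  have h1 : fderiv ℝ (fun z => c (f z)) z = (fderiv ℝ c (f z)).comp (fderiv ℝ f z) :=
    fderiv_comp z (hc.dif _) (hf.dif z)
  simp only [h, fderiv_fun_id] at h1
  refine Function.LeftInverse.injective (g := fderiv ℝ c (f z)) fun u => ?_
  exact (congrArg (fun T : X →L[ℝ] X => T u) h1).symm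

section Fixing

variable {W : Type*} [NormedAddCommGroup W] [InnerProductSpace ℝ W] [FiniteDimensional ℝ W]

theorem exists_isotopy_fixing_flat (hW : Module.finrank ℝ W = 4) {g : W → Triple × Triple}
    (hgs : ContDiff ℝ ∞ g) (hg : SphereEmb g) (hr : Radial g) {e : W} (he : ‖e‖ = 1)
    (hge : g e = 0) {r : ℝ} (hr0 : 0 < r)
    (hP : ∀ z ∈ ball (0 : Triple × Triple) r, z ∈ g '' sphere 0 1 ↔ z.2 = 0)
    {Φ Ψ : Triple × Triple → Triple × Triple} (hΦ : PosDiffeo Φ Ψ)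
    (hΦg : ∀ x ∈ sphere (0 : W) 1, Φ (g x) = g x) {f : W → Triple × Triple}
    (hfs : ContDiff ℝ ∞ f) (hf : SphereEmb f)
    (hfg : ∀ x ∈ sphere (0 : W) 1, f x ∉ g '' sphere 0 1) :
    Isotopic (g '' sphere 0 1) f (fun x => Φ (f x)) := by
  have hV : Module.finrank ℝ (Triple × Triple) = 6 := by simp
  have hdim : CoverDim 3 (sphere (0 : W) 1) := coverDim_sphere hW
  have hfix : ∀ z ∈ g '' sphere 0 1, Φ z = z := by
    rintro _ ⟨x, hx, rfl⟩
    exact hΦg x hx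
  have hΦi : Function.Injective Φ := Function.LeftInverse.injective hΦ.2.2.1
  have hΦd : ∀ z, Function.Injective (fderiv ℝ Φ z) := fun z =>
    ((fderiv ℝ Φ z).toContinuousLinearEquivOfDetNeZero (hΦ.2.2.2.2 z).ne').injective
  have hmem : ∀ z, Φ z ∈ g '' sphere 0 1 → z ∈ g '' sphere 0 1 := by
    intro z hz
    rwa [← hΦi (hfix _ hz)]
  obtain ⟨ε, hε, htriv⟩ := exists_isotopic_comp_of_det_pos (W := W) hr0 hP hΦ.1 hfix
    (hΦ.2.2.2.2 0)
  have hXc : IsCompact (f '' sphere 0 1) := (isCompact_sphere 0 1).image hfs.continuous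
  obtain ⟨ψ, hψ, hψε⟩ := exists_ambientMove_engulf hV hgs hg hr hdim he hge
    (LinearMap.ker (LinearMap.snd ℝ Triple Triple)) hr0 (fun z hz => by
      rw [hP z hz, LinearMap.mem_ker, LinearMap.snd_apply]) 4 le_rfl (f '' sphere 0 1) 3 hXc
    (fun h => by
      obtain ⟨x, hx, h⟩ := h
      exact hfg x hx ⟨-e, by simpa using he, h.symm⟩)
    (hdim.image_contDiff isBounded_sphere hfs) (by norm_num) ε hε
  have h1 := hψ.isotopic hfs hf hfg
  obtain ⟨G, hG, hGt, hG0, hG1⟩ := id h1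
  have hψf : SphereEmb fun x => ψ (f x) := by
    have := (hGt 1 (right_mem_Icc.2 zero_le_one)).1
    simpa only [hG1] using this
  have h2 := htriv (fun x => ψ (f x)) (hψ.contDiff.comp hfs) hψf fun x hx =>
    ⟨hψε _ ⟨x, hx, rfl⟩, fun h => hfg x hx ((hψ.mem_iff _).1 h)⟩
  have h3 := h1.map hΦ.1 hΦi hΦd hmem
  exact (h1.trans h2).trans h3.symm

variable {V : Type*} [NormedAddCommGroup V] [NormedSpace ℝ V] [FiniteDimensional ℝ V]

/-- Two-component links in a six-dimensional vector space which agree on the first component and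
are isotopic are isotopic relative to the first component. -/
theorem exists_isotopy_fixing (hW : Module.finrank ℝ W = 4) (hV : Module.finrank ℝ V = 6)
    {g : W → V} (hgs : ContDiff ℝ ∞ g) (hr : Radial g) {H K : ℝ × W → V}
    (hH : ContDiff ℝ ∞ H) (hK : ContDiff ℝ ∞ K)
    (hHe : ∀ t ∈ Icc (0 : ℝ) 1, SphereEmb fun x => H (t, x))
    (hKe : ∀ t ∈ Icc (0 : ℝ) 1, SphereEmb fun x => K (t, x))
    (hHK : ∀ t ∈ Icc (0 : ℝ) 1, ∀ x ∈ sphere (0 : W) 1, ∀ y ∈ sphere (0 : W) 1,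
      H (t, x) ≠ K (t, y))
    (hH0 : ∀ x, H (0, x) = g x) (hH1 : ∀ x ∈ sphere (0 : W) 1, H (1, x) = g x) :
    ∃ G : ℝ × W → V, ContDiff ℝ ∞ G ∧
      (∀ t ∈ Icc (0 : ℝ) 1, SphereEmb (fun x => G (t, x)) ∧
        ∀ x ∈ sphere (0 : W) 1, G (t, x) ∉ g '' sphere 0 1) ∧
      (∀ x ∈ sphere (0 : W) 1, G (0, x) = K (0, x)) ∧
      ∀ x ∈ sphere (0 : W) 1, G (1, x) = K (1, x) := by
  have h0 : (0 : ℝ) ∈ Icc (0 : ℝ) 1 := left_mem_Icc.2 zero_le_one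
  have hg : SphereEmb g := by simpa only [hH0] using hHe 0 h0
  obtain ⟨e, he⟩ : ∃ e : W, ‖e‖ = 1 := by
    have : Nontrivial W := Module.nontrivial_of_finrank_pos (R := ℝ) (by omega)
    exact exists_norm_eq W zero_le_one
  obtain ⟨Θ, Ξ, hΘ, hΞ, hΞΘ, hΘΞ, hΘe, r, hr0, hflat⟩ := exists_flattening hV hW hgs hg he
  have hΘi : Function.Injective Θ := Function.LeftInverse.injective hΞΘ
  have hΞi : Function.Injective Ξ := Function.LeftInverse.injective hΘΞ
  have hΘd : ∀ z, Function.Injective (fderiv ℝ Θ z) := fun z =>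
    injective_fderiv_of_leftInverse hΘ hΞ hΞΘ z
  have hΞd : ∀ z, Function.Injective (fderiv ℝ Ξ z) := fun z =>
    injective_fderiv_of_leftInverse hΞ hΘ hΘΞ z
  obtain ⟨Φ, Ψ, hΦ, hΦH, hΦK⟩ := exists_posDiffeo_following (hΘ.comp hH) (hΘ.comp hK)
    (fun t ht => (hHe t ht).comp (hH.slice t) hΘ hΘi.injOn fun _ _ => hΘd _)
    (fun t ht => (hKe t ht).comp (hK.slice t) hΘ hΘi.injOn fun _ _ => hΘd _)
    (fun t ht x hx y hy h => hHK t ht x hx y hy (hΘi h))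
  have hmem : ∀ z, Ξ z ∈ g '' sphere 0 1 → z ∈ (Θ ∘ g) '' sphere 0 1 := by
    rintro z ⟨x, hx, h⟩
    exact ⟨x, hx, by rw [Function.comp_apply, h, hΘΞ]⟩
  have hiso := exists_isotopy_fixing_flat hW (hΘ.comp hgs)
    (hg.comp hgs hΘ hΘi.injOn fun _ _ => hΘd _) (fun x hx => congrArg Θ (hr x hx)) he hΘe hr0
    hflat hΦ (fun x hx => by
      have := hΦH x hx
      simp only [Function.comp_apply, hH0, hH1 x hx] at this
      exact this)
    (f := fun x => Θ (K (0, x))) (hΘ.comp (hK.slice 0))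
    ((hKe 0 h0).comp (hK.slice 0) hΘ hΘi.injOn fun _ _ => hΘd _) (by
      rintro x hx ⟨y, hy, h⟩
      refine hHK 0 h0 y hy x hx ?_
      rw [hH0]
      exact hΘi h)
  obtain ⟨G, hG, hGt, hG0, hG1⟩ := hiso.map hΞ hΞi hΞd hmem
  refine ⟨G, hG, hGt, fun x _ => ?_, fun x hx => ?_⟩
  · rw [hG0]
    exact hΞΘ _
  · rw [hG1]
    exact (congrArg Ξ (hΦK x hx)).trans (hΞΘ _)

end Fixing

section SphereCoordinates

theorem fact_finrank_E (n : ℕ) : Fact (Module.finrank ℝ (E (n + 1)) = n + 1) :=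
  ⟨finrank_euclideanSpace_fin⟩

attribute [local instance] fact_finrank_E

/-- A smooth reparametrisation of the unit interval by the real line. -/
def unitTime (t : ℝ) : Icc (0 : ℝ) 1 := projIcc 0 1 zero_le_one (Real.smoothTransition t)

theorem contMDiff_unitTime : ContMDiff 𝓘(ℝ, ℝ) (𝓡∂ 1) ∞ unitTime :=
  contMDiffOn_projIcc.comp_contMDiff Real.smoothTransition.contDiff.contMDiff fun t =>
    ⟨Real.smoothTransition.nonneg t, Real.smoothTransition.le_one t⟩

theorem unitTime_zero : unitTime 0 = ⟨0, by norm_num⟩ := by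
  rw [unitTime, Real.smoothTransition.zero]
  exact projIcc_left _

theorem unitTime_one : unitTime 1 = ⟨1, by norm_num⟩ := by
  rw [unitTime, Real.smoothTransition.one]
  exact projIcc_right _

/-- Radial projection to the unit sphere, with a junk value at the origin. -/
def sphereProj (n : ℕ) (x : E (n + 1)) : Sph n :=
  if hx : x = 0 then ⟨EuclideanSpace.single 0 1, by simp⟩
  else ⟨‖x‖⁻¹ • x, by simp [norm_smul, hx]⟩

theorem coe_sphereProj {n : ℕ} {x : E (n + 1)} (hx : x ≠ 0) :
    (sphereProj n x : E (n + 1)) = ‖x‖⁻¹ • x := by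
  rw [sphereProj, dif_neg hx]

theorem sphereProj_coe {n : ℕ} (x : Sph n) : sphereProj n x = x := by
  have h : ‖(x : E (n + 1))‖ = 1 := by simp
  have hx : (x : E (n + 1)) ≠ 0 := by
    rw [← norm_ne_zero_iff, h]
    exact one_ne_zero
  exact Subtype.ext (by rw [coe_sphereProj hx, h, inv_one, one_smul])

theorem sphereProj_of_mem {n : ℕ} {x : E (n + 1)} (hx : x ∈ sphere (0 : E (n + 1)) 1) :
    sphereProj n x = ⟨x, hx⟩ :=
  sphereProj_coe ⟨x, hx⟩

theorem contDiffAt_coe_sphereProj {n : ℕ} {x : E (n + 1)} (hx : x ≠ 0) :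
    ContDiffAt ℝ ∞ (fun x => (sphereProj n x : E (n + 1))) x := by
  have h : ContDiffAt ℝ ∞ (fun x : E (n + 1) => ‖x‖⁻¹ • x) x :=
    ((contDiffAt_norm ℝ hx).inv (norm_ne_zero_iff.2 hx)).smul contDiffAt_id
  refine h.congr_of_eventuallyEq ?_
  filter_upwards [isOpen_ne.mem_nhds hx] with y hy using coe_sphereProj hy

theorem contMDiffAt_sphereProj {n : ℕ} {x : E (n + 1)} (hx : x ≠ 0) :
    ContMDiffAt 𝓘(ℝ, E (n + 1)) (𝓡 n) ∞ (sphereProj n) x := by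
  let U : TopologicalSpace.Opens (E (n + 1)) := ⟨{x | x ≠ 0}, isOpen_ne⟩
  have h1 : ContMDiff 𝓘(ℝ, E (n + 1)) 𝓘(ℝ, E (n + 1)) ∞
      (fun x : U => (sphereProj n (x : E (n + 1)) : E (n + 1))) := fun y =>
    contMDiffAt_subtype_iff.2 (contDiffAt_coe_sphereProj y.2).contMDiffAt
  have h2 := h1.codRestrict_sphere (n := n) fun y => (sphereProj n (y : E (n + 1))).2
  exact (contMDiffAt_subtype_iff (U := U) (x := ⟨x, hx⟩)).1 (h2 ⟨x, hx⟩)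

theorem sphereProj_smul {n : ℕ} {x : E (n + 1)} (hx : x ≠ 0) :
    sphereProj n (‖x‖⁻¹ • x) = sphereProj n x := by
  rw [← coe_sphereProj hx, sphereProj_coe]

theorem fderiv_coe_sphereProj {n : ℕ} {x : E (n + 1)} (hx : x ∈ sphere (0 : E (n + 1)) 1)
    {u : E (n + 1)} (hu : inner ℝ x u = 0) :
    fderiv ℝ (fun x => (sphereProj n x : E (n + 1))) x u = u := by
  have hx1 : ‖x‖ = 1 := by simpa using hx
  have hx0 : x ≠ 0 := by
    rw [← norm_ne_zero_iff, hx1]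
    exact one_ne_zero
  have hp : DifferentiableAt ℝ (fun x => (sphereProj n x : E (n + 1))) x :=
    (contDiffAt_coe_sphereProj hx0).differentiableAt (by simp)
  have hnd : DifferentiableAt ℝ (fun x : E (n + 1) => ‖x‖) x :=
    (contDiffAt_norm ℝ hx0 (n := 1)).differentiableAt (by simp)
  have hnu : fderiv ℝ (fun x : E (n + 1) => ‖x‖) x u = 0 := by
    have h0 : HasFDerivAt (fun x : E (n + 1) => ‖x‖ * ‖x‖) (2 • innerSL ℝ x) x := by
      simpa only [sq] using (hasStrictFDerivAt_norm_sq x).hasFDerivAt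
    have h1 := (hnd.hasFDerivAt.fun_mul hnd.hasFDerivAt).unique h0
    have h2 := congrArg (fun T : E (n + 1) →L[ℝ] ℝ => T u) h1
    simp [hx1, hu] at h2
    linarith
  have h1 : (fun y : E (n + 1) => ‖y‖ • (sphereProj n y : E (n + 1))) =ᶠ[𝓝 x] fun y => y := by
    filter_upwards [isOpen_ne.mem_nhds hx0] with y hy
    rw [coe_sphereProj hy, smul_inv_smul₀ (norm_ne_zero_iff.2 hy)]
  have h2 := h1.fderiv_eq (𝕜 := ℝ)
  rw [fderiv_fun_smul hnd hp, fderiv_fun_id] at h2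
  have h3 := congrArg (fun T : E (n + 1) →L[ℝ] E (n + 1) => T u) h2
  simpa [hx1, hnu] using h3

theorem contMDiff_coe_Sph (n : ℕ) :
    ContMDiff (𝓡 n) 𝓘(ℝ, E (n + 1)) ∞ (fun x : Sph n => (x : E (n + 1))) :=
  contMDiff_coe_sphere

theorem injective_mfderiv_coe_Sph {n : ℕ} (x : Sph n) :
    Function.Injective (mfderiv (𝓡 n) 𝓘(ℝ, E (n + 1)) (fun x : Sph n => (x : E (n + 1))) x) :=
  fun _ _ h => injective_mvfderiv_subtypeVal_sphere x h

theorem ContMDiff.codRestrict_Sph {F M H : Type*} [NormedAddCommGroup F] [NormedSpace ℝ F]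
    [TopologicalSpace H] {I : ModelWithCorners ℝ F H} [TopologicalSpace M] [ChartedSpace H M]
    [IsManifold I ∞ M] {n : ℕ} {f : M → Sph n}
    (hf : ContMDiff I 𝓘(ℝ, E (n + 1)) ∞ fun x => (f x : E (n + 1))) :
    ContMDiff I (𝓡 n) ∞ f :=
  hf.codRestrict_sphere (n := n) fun x => (f x).2

/-- A map between spheres with a smooth left inverse, defined near its image in the ambient space,
is a smooth embedding. -/
theorem isSmoothEmbedding_of_leftInverse {m n : ℕ} {f : Sph m → Sph n}
    (hf : ContMDiff (𝓡 m) (𝓡 n) ∞ f) {L : E (n + 1) → E (m + 1)}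
    (hL : ∀ x, DifferentiableAt ℝ L (f x : E (n + 1)))
    (hLf : ∀ x, L (f x : E (n + 1)) = (x : E (m + 1))) : IsSmoothEmbedding f := by
  have hinj : Function.Injective f := fun x y h => Subtype.ext (by rw [← hLf x, ← hLf y, h])
  refine ⟨hf, (hf.continuous.isClosedEmbedding hinj).isEmbedding, fun x => ?_⟩
  have h1 : MDifferentiableAt (𝓡 m) (𝓡 n) f x := (hf x).mdifferentiableAt (by simp)
  have h2 : MDifferentiableAt (𝓡 n) 𝓘(ℝ, E (m + 1)) (fun y : Sph n => L (y : E (n + 1))) (f x) :=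
    (hL x).mdifferentiableAt.comp (f x) ((contMDiff_coe_Sph n (f x)).mdifferentiableAt (by simp))
  have h3 := mfderiv_comp x h2 h1
  have h4 : (fun y : Sph n => L (y : E (n + 1))) ∘ f = fun x : Sph m => (x : E (m + 1)) :=
    funext hLf
  rw [h4] at h3
  have h5 := injective_mfderiv_coe_Sph x
  rw [h3] at h5
  exact Function.Injective.of_comp h5

/-- The radial extension of a smooth embedding of spheres, followed by an ambient map `σ` with a
differentiable left inverse `τ`, satisfies the embedding condition along the unit sphere. -/
theorem IsSmoothEmbedding.sphereEmb {m n : ℕ} {f : Sph m → Sph n} (hf : IsSmoothEmbedding f)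
    {V : Type*} [NormedAddCommGroup V] [NormedSpace ℝ V] {σ : E (n + 1) → V} {τ : V → E (n + 1)}
    (hτ : Differentiable ℝ τ) (hτσ : ∀ x, τ (σ (f x : E (n + 1))) = f x)
    {g : E (m + 1) → V} (hg : Differentiable ℝ g)
    (hgf : ∀ x, 1 / 2 ≤ ‖x‖ → g x = σ (f (sphereProj m x) : E (n + 1))) : SphereEmb g := by
  have hmem : ∀ {x : E (m + 1)}, x ∈ sphere (0 : E (m + 1)) 1 → ‖x‖ = 1 := fun hx => by
    simpa using hx
  refine ⟨fun x hx y hy h => ?_, fun x hx u hu h => ?_⟩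
  · rw [hgf x (by rw [hmem hx]; norm_num), hgf y (by rw [hmem hy]; norm_num)] at h
    have h1 : sphereProj m x = sphereProj m y :=
      hf.2.1.injective (Subtype.ext (by rw [← hτσ, h, hτσ]))
    rw [sphereProj_of_mem hx, sphereProj_of_mem hy] at h1
    exact congrArg Subtype.val h1
  · have hx0 : x ≠ 0 := by
      rw [← norm_ne_zero_iff, hmem hx]
      exact one_ne_zero
    have hp : MDifferentiableAt 𝓘(ℝ, E (m + 1)) (𝓡 m) (sphereProj m) x :=
      (contMDiffAt_sphereProj hx0).mdifferentiableAt (by simp)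
    have hfd : MDifferentiableAt (𝓡 m) (𝓡 n) f (sphereProj m x) :=
      (hf.1 _).mdifferentiableAt (by simp)
    have hcm : MDifferentiableAt (𝓡 m) 𝓘(ℝ, E (m + 1)) (fun x : Sph m => (x : E (m + 1)))
        (sphereProj m x) := (contMDiff_coe_Sph m _).mdifferentiableAt (by simp)
    have hcn : MDifferentiableAt (𝓡 n) 𝓘(ℝ, E (n + 1)) (fun x : Sph n => (x : E (n + 1)))
        (f (sphereProj m x)) := (contMDiff_coe_Sph n _).mdifferentiableAt (by simp)
    have he : τ ∘ g =ᶠ[𝓝 x] (fun x : Sph n => (x : E (n + 1))) ∘ f ∘ sphereProj m := by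
      have ho : {y : E (m + 1) | 1 / 2 < ‖y‖} ∈ 𝓝 x :=
        (isOpen_lt continuous_const continuous_norm).mem_nhds (by
          rw [mem_ofPred_eq, hmem hx]; norm_num)
      filter_upwards [ho] with y hy
      simp only [Function.comp_apply]
      rw [hgf y (le_of_lt hy), hτσ]
    have h1 : fderiv ℝ (τ ∘ g) x u = 0 := by
      rw [fderiv_comp x (hτ _) (hg x), ContinuousLinearMap.comp_apply, h, map_zero]
    rw [he.fderiv_eq, ← mfderiv_eq_fderiv, mfderiv_comp x hcn (hfd.comp x hp),
      mfderiv_comp x hfd hp] at h1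
    have h1' : mfderiv (𝓡 m) (𝓡 n) f (sphereProj m x)
        (mfderiv 𝓘(ℝ, E (m + 1)) (𝓡 m) (sphereProj m) x u) = 0 :=
      injective_mfderiv_coe_Sph _ (h1.trans (map_zero _).symm)
    have h2 : mfderiv 𝓘(ℝ, E (m + 1)) (𝓡 m) (sphereProj m) x u = 0 :=
      hf.2.2 _ (h1'.trans (map_zero _).symm)
    have h3 : fderiv ℝ ((fun x : Sph m => (x : E (m + 1))) ∘ sphereProj m) x u = 0 := by
      rw [← mfderiv_eq_fderiv, mfderiv_comp x hcm hp]
      exact (congrArg (mfderiv (𝓡 m) 𝓘(ℝ, E (m + 1)) (fun x : Sph m => (x : E (m + 1)))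
        (sphereProj m x)) h2).trans (map_zero _)
    rw [← fderiv_coe_sphereProj hx hu]
    exact h3

end SphereCoordinates

section Stereographic

/-- Smooth families of maps of spheres, read in the ambient space through `σ`, extend to smooth
families on the ambient space which are radial away from the origin. -/
theorem exists_radialExtension {m n : ℕ} {H : Icc (0 : ℝ) 1 × Sph m → Sph n}
    (hH : ContMDiff ((𝓡∂ 1).prod (𝓡 m)) (𝓡 n) ∞ H) {V : Type*} [NormedAddCommGroup V]
    [NormedSpace ℝ V] {σ : E (n + 1) → V}
    (hσ : ∀ p, ContDiffAt ℝ ∞ σ (H p : E (n + 1))) :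
    ∃ F : ℝ × E (m + 1) → V, ContDiff ℝ ∞ F ∧ ∀ t x, 1 / 2 ≤ ‖x‖ →
      F (t, x) = σ (H (unitTime t, sphereProj m x) : E (n + 1)) := by
  obtain ⟨χ, hχ, -, -, hχ1, hχ0⟩ := exists_smooth_cutoff
    (isCompact_closedBall (0 : E (m + 1)) (1 / 4)) (Z := {x : E (m + 1) | 1 / 2 ≤ ‖x‖})
    (isClosed_le continuous_const continuous_norm) (by
      rw [Set.disjoint_left]
      intro x hx hx'
      rw [mem_closedBall_zero_iff] at hx
      rw [mem_ofPred_eq] at hx'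
      linarith)
  refine ⟨fun p => (1 - χ p.2) • σ (H (unitTime p.1, sphereProj m p.2) : E (n + 1)), ?_,
    fun t x hx => ?_⟩
  · refine contDiff_iff_contDiffAt.2 fun p => ?_
    by_cases hp : p.2 = 0
    · refine (contDiffAt_const (c := (0 : V))).congr_of_eventuallyEq ?_
      have ho : {q : ℝ × E (m + 1) | ‖q.2‖ < 1 / 4} ∈ 𝓝 p :=
        (isOpen_lt continuous_snd.norm continuous_const).mem_nhds (by simp [hp])
      filter_upwards [ho] with q hq
      rw [hχ1 q.2 (mem_closedBall_zero_iff.2 (le_of_lt hq)), sub_self, zero_smul]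
    · refine (contDiff_const.sub (hχ.comp contDiff_snd)).contDiffAt.smul ?_
      have h1 : ContMDiffAt 𝓘(ℝ, ℝ × E (m + 1)) (𝓡∂ 1) ∞
          (fun q : ℝ × E (m + 1) => unitTime q.1) p :=
        (contMDiff_unitTime.comp contDiff_fst.contMDiff) p
      have h2 : ContMDiffAt 𝓘(ℝ, ℝ × E (m + 1)) (𝓡 m) ∞
          (fun q : ℝ × E (m + 1) => sphereProj m q.2) p :=
        (contMDiffAt_sphereProj hp).comp p contDiff_snd.contMDiff.contMDiffAt
      have h3 : ContMDiffAt 𝓘(ℝ, ℝ × E (m + 1)) (𝓡 n) ∞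
          (fun q : ℝ × E (m + 1) => H (unitTime q.1, sphereProj m q.2)) p :=
        (hH _).comp p (h1.prodMk h2)
      have h4 : ContMDiffAt 𝓘(ℝ, ℝ × E (m + 1)) 𝓘(ℝ, E (n + 1)) ∞
          (fun q : ℝ × E (m + 1) => (H (unitTime q.1, sphereProj m q.2) : E (n + 1))) p :=
        (contMDiff_coe_Sph n _).comp p h3
      exact (hσ _).comp p (contMDiffAt_iff_contDiffAt.1 h4)
  · simp only
    rw [hχ0 x hx, sub_zero, one_smul]

theorem exists_unitTime_eq (s : Icc (0 : ℝ) 1) : ∃ t ∈ Icc (0 : ℝ) 1, unitTime t = s := by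
  have h1 : s.1 ∈ Icc (Real.smoothTransition 0) (Real.smoothTransition 1) := by
    rw [Real.smoothTransition.zero, Real.smoothTransition.one]
    exact s.2
  obtain ⟨t, ht, hts⟩ := intermediate_value_Icc zero_le_one
    Real.smoothTransition.continuous.continuousOn h1
  exact ⟨t, ht, by rw [unitTime, hts, projIcc_val]⟩

theorem coverDim_range_family {m n : ℕ} {H : Icc (0 : ℝ) 1 × Sph m → Sph n}
    (hH : ContMDiff ((𝓡∂ 1).prod (𝓡 m)) (𝓡 n) ∞ H) :
    CoverDim (1 + m) (range fun p => (H p : E (n + 1))) := by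
  obtain ⟨F, hF, hFe⟩ := exists_radialExtension hH (σ := id) fun _ => contDiffAt_id
  have hd : CoverDim (1 + m) (Icc (0 : ℝ) 1 ×ˢ sphere (0 : E (m + 1)) 1) :=
    (coverDim_Icc 0 1).prod (coverDim_sphere (by simp))
  refine (hd.image_contDiff ((isBounded_Icc 0 1).prod isBounded_sphere) hF).mono ?_
  rintro _ ⟨⟨s, x⟩, rfl⟩
  obtain ⟨t, ht, rfl⟩ := exists_unitTime_eq s
  refine ⟨(t, (x : E (m + 1))), ⟨ht, x.2⟩, ?_⟩
  rw [hFe t x (by simp; norm_num), sphereProj_coe]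
  rfl

/-- A subset of the sphere of smaller covering dimension is not everything. -/
theorem exists_mem_sphere_notMem {n : ℕ} {X : Set (E (n + 1))} {d : ℝ} (hX : CoverDim d X)
    (hXb : Bornology.IsBounded X) (hd : d < n) : ∃ p ∈ sphere (0 : E (n + 1)) 1, p ∉ X := by
  have hY : CoverDim (1 + d) ((fun q : ℝ × E (n + 1) => q.1 • q.2) '' (Icc (0 : ℝ) 1 ×ˢ X)) :=
    ((coverDim_Icc 0 1).prod hX).image_contDiff ((isBounded_Icc 0 1).prod hXb)
      (contDiff_fst.smul contDiff_snd)
  have h1 := hY.ae_fiber (MeasureTheory.volume : MeasureTheory.Measure (E (n + 1)))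
    (m := id) (L := 1) LipschitzWith.id.lipschitzOnWith (η := (n - d) / 2) (by linarith)
  have h2 := MeasureTheory.Measure.dense_of_ae h1
  obtain ⟨v, ⟨hv1, hv0⟩, hv⟩ := h2.inter_open_nonempty (ball (0 : E (n + 1)) 1 ∩ {0}ᶜ)
    (isOpen_ball.inter isOpen_compl_singleton)
    ⟨EuclideanSpace.single 0 (1 / 2), by simp; norm_num, by simp⟩
  rw [mem_ofPred_eq] at hv
  have h3 := hv.eq_empty (by simp; linarith)
  have hvn : ‖v‖ ≠ 0 := norm_ne_zero_iff.2 hv0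
  refine ⟨‖v‖⁻¹ • v, by simp [norm_smul, hvn], fun hmem => ?_⟩
  rw [mem_ball_zero_iff] at hv1
  exact (h3 ▸ (⟨⟨(‖v‖, ‖v‖⁻¹ • v), ⟨⟨norm_nonneg v, hv1.le⟩, hmem⟩, smul_inv_smul₀ hvn v⟩, rfl⟩ :
    v ∈ (fun q : ℝ × E (n + 1) => q.1 • q.2) '' (Icc (0 : ℝ) 1 ×ˢ X) ∩ id ⁻¹' {v}) :
      v ∈ (∅ : Set (E (n + 1))))

theorem contDiffAt_stereoToFun_of_ne {n : ℕ} {p x : E (n + 1)} (hp : ‖p‖ = 1) (hx : ‖x‖ = 1)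
    (hne : x ≠ p) : ContDiffAt ℝ ∞ (stereoToFun p) x := by
  refine contDiffOn_stereoToFun.contDiffAt (IsOpen.mem_nhds ?_ ?_)
  · exact isOpen_ne_fun (innerSL ℝ p).continuous continuous_const
  · intro h
    exact hne ((inner_eq_one_iff_of_norm_eq_one hp hx).1 h).symm

theorem stereoInvFunAux_stereoToFun {n : ℕ} {p x : E (n + 1)} (hp : ‖p‖ = 1) (hx : ‖x‖ = 1)
    (hne : x ≠ p) : stereoInvFunAux p (stereoToFun p x : E (n + 1)) = x :=
  congrArg Subtype.val (stereo_left_inv hp (x := ⟨x, by simpa using hx⟩) hne)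

end Stereographic

theorem Sph.norm_coe {n : ℕ} (x : Sph n) : ‖(x : E (n + 1))‖ = 1 := by simp

theorem stereoInvFunAux_coe_ne {n : ℕ} {p : E (n + 1)} (hp : ‖p‖ = 1) (w : (ℝ ∙ p)ᗮ) :
    stereoInvFunAux p (w : E (n + 1)) ≠ p := fun h =>
  stereoInvFun_ne_north_pole hp w (Subtype.ext h)

theorem stereoToFun_stereoInvFunAux {n : ℕ} {p : E (n + 1)} (hp : ‖p‖ = 1) (w : (ℝ ∙ p)ᗮ) :
    stereoToFun p (stereoInvFunAux p (w : E (n + 1))) = w :=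
  stereo_right_inv hp w

theorem norm_stereoInvFunAux {n : ℕ} {p : E (n + 1)} (hp : ‖p‖ = 1) (w : (ℝ ∙ p)ᗮ) :
    ‖stereoInvFunAux p (w : E (n + 1))‖ = 1 := by
  simpa only [mem_sphere_zero_iff_norm] using stereoInvFunAux_mem hp w.2

theorem contDiff_stereoInvFunAux_coe {n : ℕ} (p : E (n + 1)) :
    ContDiff ℝ ∞ fun w : (ℝ ∙ p)ᗮ => stereoInvFunAux p (w : E (n + 1)) :=
  contDiff_stereoInvFunAux.comp (ℝ ∙ p)ᗮ.subtypeL.contDiff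

/-- A smooth family of embedded spheres in the image of stereographic projection lifts to a smooth
family of embeddings of spheres. -/
theorem exists_isotopy_of_sphereEmb {m n : ℕ} {p : E (n + 1)} (hp : ‖p‖ = 1)
    {G : ℝ × E (m + 1) → (ℝ ∙ p)ᗮ} (hG : ContDiff ℝ ∞ G)
    (hGe : ∀ t ∈ Icc (0 : ℝ) 1, SphereEmb fun x => G (t, x)) :
    ∃ K : Icc (0 : ℝ) 1 × Sph m → Sph n,
      ContMDiff ((𝓡∂ 1).prod (𝓡 m)) (𝓡 n) ∞ K ∧
      (∀ t, IsSmoothEmbedding fun x => K (t, x)) ∧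
      ∀ t x, (K (t, x) : E (n + 1)) = stereoInvFunAux p (G (t, x) : E (n + 1)) := by
  let K : Icc (0 : ℝ) 1 × Sph m → Sph n := fun q => stereoInvFun hp (G (q.1, q.2))
  have hK : ContMDiff ((𝓡∂ 1).prod (𝓡 m)) (𝓡 n) ∞ K := by
    have h1 : ContMDiff ((𝓡∂ 1).prod (𝓡 m)) 𝓘(ℝ, ℝ × E (m + 1)) ∞
        (fun q : Icc (0 : ℝ) 1 × Sph m => ((q.1 : ℝ), (q.2 : E (m + 1)))) :=
      (contMDiff_subtypeVal_Icc.comp contMDiff_fst).prodMk_space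
        ((contMDiff_coe_Sph m).comp contMDiff_snd)
    exact (((contDiff_stereoInvFunAux_coe p).comp hG).contMDiff.comp h1).codRestrict_Sph
  refine ⟨K, hK, fun t => ?_, fun t x => rfl⟩
  obtain ⟨c, hc, hcG⟩ := (hGe t t.2).exists_leftInverse (hG.slice t)
  have hKt : ContMDiff (𝓡 m) (𝓡 n) ∞ fun x => K (t, x) :=
    hK.comp (contMDiff_const.prodMk contMDiff_id)
  refine isSmoothEmbedding_of_leftInverse hKt (L := c ∘ stereoToFun p) (fun x => ?_) fun x => ?_
  · exact (hc.dif _).comp _ ((contDiffAt_stereoToFun_of_ne hp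
      (norm_stereoInvFunAux hp _) (stereoInvFunAux_coe_ne hp _)).differentiableAt (by simp))
  · exact (congrArg c (stereoToFun_stereoInvFunAux hp _)).trans (hcG x x.2)

end

theorem statement12 (g₁ g₂ g₂' : Sph 3 → Sph 6)
    (hg₁ : IsSmoothEmbedding g₁) (hg₂ : IsSmoothEmbedding g₂)
    (hg₂' : IsSmoothEmbedding g₂')
    (hd : ∀ x y, g₂ x ≠ g₁ y) (hd' : ∀ x y, g₂' x ≠ g₁ y)
    (H K : Set.Icc (0 : ℝ) 1 × Sph 3 → Sph 6)
    (hH : ContMDiff ((𝓡∂ 1).prod (𝓡 3)) (𝓡 6) (⊤ : ℕ∞) H)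
    (hK : ContMDiff ((𝓡∂ 1).prod (𝓡 3)) (𝓡 6) (⊤ : ℕ∞) K)
    (hHs : ∀ t : Set.Icc (0 : ℝ) 1, IsSmoothEmbedding fun x => H (t, x))
    (hKs : ∀ t : Set.Icc (0 : ℝ) 1, IsSmoothEmbedding fun x => K (t, x))
    (hdisj : ∀ (t : Set.Icc (0 : ℝ) 1) (x y : Sph 3), H (t, x) ≠ K (t, y))
    (hH0 : ∀ x, H (⟨0, by norm_num⟩, x) = g₁ x)
    (hH1 : ∀ x, H (⟨1, by norm_num⟩, x) = g₁ x)
    (hK0 : ∀ x, K (⟨0, by norm_num⟩, x) = g₂ x)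
    (hK1 : ∀ x, K (⟨1, by norm_num⟩, x) = g₂' x) :
    ∃ H' K' : Set.Icc (0 : ℝ) 1 × Sph 3 → Sph 6,
      ContMDiff ((𝓡∂ 1).prod (𝓡 3)) (𝓡 6) (⊤ : ℕ∞) H' ∧
      ContMDiff ((𝓡∂ 1).prod (𝓡 3)) (𝓡 6) (⊤ : ℕ∞) K' ∧
      (∀ t : Set.Icc (0 : ℝ) 1, IsSmoothEmbedding fun x => H' (t, x)) ∧
      (∀ t : Set.Icc (0 : ℝ) 1, IsSmoothEmbedding fun x => K' (t, x)) ∧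
      (∀ (t : Set.Icc (0 : ℝ) 1) (x y : Sph 3), H' (t, x) ≠ K' (t, y)) ∧
      (∀ (t : Set.Icc (0 : ℝ) 1) (x : Sph 3), H' (t, x) = g₁ x) ∧
      (∀ x, K' (⟨0, by norm_num⟩, x) = g₂ x) ∧
      (∀ x, K' (⟨1, by norm_num⟩, x) = g₂' x) := by
  obtain ⟨p, hpS, hpX⟩ := exists_mem_sphere_notMem
    ((coverDim_range_family hH).union (coverDim_range_family hK))
    ((Metric.isBounded_sphere (x := (0 : E 7)) (r := 1)).subset (by
      rintro _ (⟨q, rfl⟩ | ⟨q, rfl⟩)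
      · exact (H q).2
      · exact (K q).2)) (by norm_num)
  have hp : ‖p‖ = 1 := by simpa only [mem_sphere_zero_iff_norm] using hpS
  have hHp : ∀ q, (H q : E 7) ≠ p := fun q h => hpX (Or.inl ⟨q, h⟩)
  have hKp : ∀ q, (K q : E 7) ≠ p := fun q h => hpX (Or.inr ⟨q, h⟩)
  obtain ⟨F, hF, hFe⟩ := exists_radialExtension hH (σ := stereoToFun p) fun q =>
    contDiffAt_stereoToFun_of_ne hp (Sph.norm_coe _) (hHp q)
  obtain ⟨F', hF', hFe'⟩ := exists_radialExtension hK (σ := stereoToFun p) fun q =>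
    contDiffAt_stereoToFun_of_ne hp (Sph.norm_coe _) (hKp q)
  have hτH : ∀ q, stereoInvFunAux p (stereoToFun p (H q : E 7) : E 7) = H q := fun q =>
    stereoInvFunAux_stereoToFun hp (Sph.norm_coe _) (hHp q)
  have hτK : ∀ q, stereoInvFunAux p (stereoToFun p (K q : E 7) : E 7) = K q := fun q =>
    stereoInvFunAux_stereoToFun hp (Sph.norm_coe _) (hKp q)
  have hτ := (contDiff_stereoInvFunAux_coe p).dif
  have hle : ∀ x : E 4, x ∈ Metric.sphere (0 : E 4) 1 → 1 / 2 ≤ ‖x‖ := fun x hx => by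
    rw [mem_sphere_zero_iff_norm.1 hx]
    norm_num
  have hFS : ∀ t (x : Sph 3), F (t, (x : E 4)) = stereoToFun p (H (unitTime t, x) : E 7) :=
    fun t x => by rw [hFe t x (hle x x.2), sphereProj_coe]
  have hFS' : ∀ t (x : Sph 3), F' (t, (x : E 4)) = stereoToFun p (K (unitTime t, x) : E 7) :=
    fun t x => by rw [hFe' t x (hle x x.2), sphereProj_coe]
  have hV : Module.finrank ℝ (ℝ ∙ p)ᗮ = 6 := by
    have := fact_finrank_E 6
    exact Submodule.finrank_orthogonal_span_singleton (ne_zero_of_mem_unit_sphere ⟨p, hpS⟩)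
  obtain ⟨G, hG, hGe, hG0, hG1⟩ := exists_isotopy_fixing (W := E 4) (by simp) hV
    (g := fun x => F (0, x)) (hF.slice 0)
    (fun x hx => by
      have hx0 : x ≠ 0 := fun h => by
        rw [h, norm_zero] at hx
        norm_num at hx
      have h1 : 1 / 2 ≤ ‖‖x‖⁻¹ • x‖ := hle _ (by simp [norm_smul, hx0])
      simp only
      rw [hFe 0 x hx, hFe 0 _ h1, sphereProj_smul hx0])
    hF hF'
    (fun t _ => (hHs (unitTime t)).sphereEmb hτ (fun _ => hτH _) (hF.slice t).dif (hFe t))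
    (fun t _ => (hKs (unitTime t)).sphereEmb hτ (fun _ => hτK _) (hF'.slice t).dif (hFe' t))
    (fun t _ x hx y hy h => by
      rw [hFS t ⟨x, hx⟩, hFS' t ⟨y, hy⟩] at h
      exact hdisj _ _ _ (Subtype.ext (by rw [← hτH, h, hτK])))
    (fun _ => rfl)
    (fun x hx => by
      rw [hFS 1 ⟨x, hx⟩, hFS 0 ⟨x, hx⟩, unitTime_one, unitTime_zero, hH0, hH1])
  obtain ⟨K', hK', hKe', hKG⟩ := exists_isotopy_of_sphereEmb hp hG fun t ht => (hGe t ht).1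
  refine ⟨fun q => g₁ q.2, K', hg₁.1.comp contMDiff_snd, hK', fun _ => hg₁, hKe', ?_,
    fun _ _ => rfl, fun x => Subtype.ext ?_, fun x => Subtype.ext ?_⟩
  · intro t x y h
    refine (hGe t t.2).2 y y.2 ⟨x, x.2, ?_⟩
    have h1 := congrArg (fun z : Sph 6 => stereoToFun p (z : E 7)) h
    simp only at h1 ⊢
    rw [hKG, stereoToFun_stereoInvFunAux hp] at h1
    rw [hFS, unitTime_zero, hH0, h1]
  · rw [hKG, hG0 x x.2, hFS', unitTime_zero, hτK, hK0]
  · rw [hKG, hG1 x x.2, hFS', unitTime_one, hτK, hK1]
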